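/- If H is a 3-uniform hypergraph containing no linear cycle and not containing K_5^3 (the complete 3-uniform hypergraph on 5 vertices) as a subhypergraph, then H is 2-colorable, i.e., there is a coloring of V(H) with 2 colors such that no hyperedge is monochromatic. -/

import Mathlib

/-- A linear cycle of length `k ≥ 3` in a 3-uniform hypergraph with edge set `E`:
an alternating cyclic sequence of distinct vertices `v i` and distinct hyperedges `h i`
with `h i ∩ h (i+1) = {v (i+1)}` and non-consecutive hyperedges disjoint. -/
def IsLinearCycle {V : Type*} [DecidableEq V] (E : Finset (Finset V)) (k : ℕ)
    (v : ZMod k → V) (h : ZMod k → Finset V) : Prop :=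
  3 ≤ k ∧ Function.Injective v ∧ Function.Injective h ∧
    (∀ i, h i ∈ E) ∧ (∀ i, h i ∩ h (i + 1) = {v (i + 1)}) ∧
    (∀ i j, i ≠ j → i + 1 ≠ j → j + 1 ≠ i → h i ∩ h j = ∅)

/-- `E` contains a linear cycle. -/
def HasLinearCycle {V : Type*} [DecidableEq V] (E : Finset (Finset V)) : Prop :=
  ∃ (k : ℕ) (v : ZMod k → V) (h : ZMod k → Finset V), IsLinearCycle E k v h

/-- The degree of a vertex: the number of hyperedges containing it. -/
def hDegree {V : Type*} [DecidableEq V] (E : Finset (Finset V)) (v : V) : ℕ :=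
  (E.filter (fun e => v ∈ e)).card

/-- The support of a vertex `v` in a hyperedge `h`: the pairs of `h` that form a
hyperedge together with `v`. -/
def hSupport {V : Type*} [DecidableEq V] (E : Finset (Finset V)) (h : Finset V) (v : V) :
    Finset (Finset V) :=
  (h.powersetCard 2).filter (fun p => insert v p ∈ E)

/-- A pair of vertices is thick if at least two hyperedges contain it. -/
def ThickPair {V : Type*} [DecidableEq V] (E : Finset (Finset V)) (a b : V) : Prop :=
  2 ≤ (E.filter (fun e => a ∈ e ∧ b ∈ e)).card

/-- A hyperedge is thick if each of its pairs is contained in at least two hyperedges. -/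
def ThickEdge {V : Type*} [DecidableEq V] (E : Finset (Finset V)) (h : Finset V) : Prop :=
  ∀ p ∈ h.powersetCard 2, 2 ≤ (E.filter (fun e => p ⊆ e)).card

/-- `v ∉ h` is strongly associated to the hyperedge `h` if at least two of the 3-sets
formed by `v` and a pair of `h` are hyperedges. -/
def StronglyAssoc {V : Type*} [DecidableEq V] (E : Finset (Finset V)) (h : Finset V) (v : V) :
    Prop :=
  v ∉ h ∧ 2 ≤ (hSupport E h v).card

/-- A linear path of length `k` (given by its sequence of hyperedges): consecutive
hyperedges meet in exactly one vertex, non-consecutive ones are disjoint. -/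
def IsLinearPath {V : Type*} [DecidableEq V] (E : Finset (Finset V)) (k : ℕ)
    (h : Fin k → Finset V) : Prop :=
  Function.Injective h ∧ (∀ i, h i ∈ E) ∧
    (∀ i j : Fin k, (i : ℕ) + 1 = (j : ℕ) → (h i ∩ h j).card = 1) ∧
    (∀ i j : Fin k, (i : ℕ) + 2 ≤ (j : ℕ) → h i ∩ h j = ∅)

/-- A linear tree with vertex set `S` and edge set `T`: built from a single vertex by
repeatedly adding hyperedges meeting the current vertex set in exactly one vertex. -/
inductive IsLinearTree {V : Type*} [DecidableEq V] : Finset V → Finset (Finset V) → Prop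
  | single (v : V) : IsLinearTree {v} ∅
  | extend {S : Finset V} {T : Finset (Finset V)} (e : Finset V) :
      IsLinearTree S T → e.card = 3 → (e ∩ S).card = 1 → IsLinearTree (S ∪ e) (insert e T)

/-- Linear path from `x` to `y` with vertex set `W` and `n` edges. -/
inductive LP {V : Type*} [DecidableEq V] (E : Finset (Finset V)) :
    V → V → Finset V → ℕ → Prop
  | nil (x : V) : LP E x x {x} 0
  | cons {x w y : V} {e W : Finset V} {n : ℕ} : e ∈ E → x ∈ e → w ∈ e → x ≠ w →
      (∀ z ∈ e, z ∈ W → z = w) → LP E w y W n → LP E x y (e ∪ W) (n + 1)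

def HasCyc {V : Type*} [DecidableEq V] (E : Finset (Finset V)) : Prop :=
  ∃ (x y : V) (W : Finset V) (n : ℕ) (e : Finset V), 2 ≤ n ∧ LP E x y W n ∧ e ∈ E ∧
    x ∈ e ∧ y ∈ e ∧ ∀ z ∈ e, z ∈ W → z = x ∨ z = y

section paths
variable {V : Type*} [DecidableEq V] {E F : Finset (Finset V)}

theorem LP.left_mem {x y : V} {W : Finset V} {n : ℕ} (h : LP E x y W n) : x ∈ W := by
  cases h <;> simp_all

theorem LP.right_mem {x y : V} {W : Finset V} {n : ℕ} (h : LP E x y W n) : y ∈ W := by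
  induction h with
  | nil => simp
  | cons _ _ _ _ _ _ ih => simp [ih]

theorem LP.mono {x y : V} {W : Finset V} {n : ℕ} (h : LP E x y W n) (hEF : E ⊆ F) :
    LP F x y W n := by
  induction h with
  | nil x => exact LP.nil x
  | cons he hx hw hne hz _ ih => exact LP.cons (hEF he) hx hw hne hz ih

theorem HasCyc.mono (h : HasCyc E) (hEF : E ⊆ F) : HasCyc F := by
  obtain ⟨x, y, W, n, e, hn, hp, he, h1⟩ := h
  exact ⟨x, y, W, n, e, hn, hp.mono hEF, hEF he, h1⟩

theorem LP.ne {x y : V} {W : Finset V} {n : ℕ} (h : LP E x y W n) (hn : n ≠ 0) : x ≠ y := by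
  cases h with
  | nil => simp at hn
  | cons he hx hw hne hz hp =>
    rintro rfl
    exact hne (hz _ hx hp.right_mem)

theorem LP.pos {x y : V} {W : Finset V} {n : ℕ} (h : LP E x y W n) (hn : x ≠ y) : 1 ≤ n := by
  cases h with
  | nil => simp at hn
  | cons => omega

theorem LP.single {x y : V} {e : Finset V} (he : e ∈ E) (hx : x ∈ e) (hy : y ∈ e) (hne : x ≠ y) :
    LP E x y e 1 := by
  have h := LP.cons he hx hy hne (W := {y}) (by simp) (LP.nil y)
  have h2 : e ∪ {y} = e := by
    ext z; simp only [Finset.mem_union, Finset.mem_singleton]; grind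
  rwa [h2] at h

theorem LP.append {x y z : V} {W U : Finset V} {n m : ℕ} (h : LP E x y W n)
    (h2 : LP E y z U m) (hd : ∀ t ∈ W, t ∈ U → t = y) : LP E x z (W ∪ U) (n + m) := by
  induction h with
  | nil x =>
    have h3 : {x} ∪ U = U := by
      have := h2.left_mem
      ext t; simp only [Finset.mem_union, Finset.mem_singleton]; grind
    rw [h3]; simpa using h2
  | @cons x w y e W n he hx hw hne hz hp ih =>
    have ih := ih h2 (fun t ht => hd t (Finset.mem_union_right _ ht))
    have := hp.right_mem
    have h4 := LP.cons he hx hw hne (by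
      intro t ht ht2
      rcases Finset.mem_union.1 ht2 with h | h
      · exact hz t ht h
      · have := hd t (Finset.mem_union_left _ ht) h
        subst this
        exact hz t ht (by assumption)) ih
    rw [Finset.union_assoc]
    convert h4 using 1
    omega

theorem LP.reverse {x y : V} {W : Finset V} {n : ℕ} (h : LP E x y W n) : LP E y x W n := by
  induction h with
  | nil x => exact LP.nil x
  | cons he hx hw hne hz hp ih =>
    have := ih.append (LP.single he hw hx hne.symm) (fun t ht ht2 => hz t ht2 ht)
    rwa [Finset.union_comm] at this

/-- Truncation. -/
theorem LP.trunc {x y : V} {W : Finset V} {n : ℕ} (h : LP E x y W n) {v : V} (hv : v ∈ W) :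
    ∃ W1 m, W1 ⊆ W ∧ LP E x v W1 m := by
  induction h with
  | nil x =>
    simp at hv; subst hv
    exact ⟨_, _, subset_rfl, LP.nil _⟩
  | @cons x w y e W n he hx hw hne hz hp ih =>
    by_cases hvW : v ∈ W
    · obtain ⟨W1, m, hs, hq⟩ := ih hvW
      exact ⟨e ∪ W1, m + 1, Finset.union_subset_union_right hs,
        LP.cons he hx hw hne (fun z h1 h2 => hz z h1 (hs h2)) hq⟩
    · have hve : v ∈ e := by simpa [hvW] using hv
      by_cases hxv : x = v
      · subst hxv
        exact ⟨{x}, 0, by simpa using Or.inl hx, LP.nil x⟩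
      · exact ⟨e, 1, Finset.subset_union_left, LP.single he hx hve hxv⟩

/-- Decomposition by both end edges. -/
theorem LP.ends {x y : V} {W : Finset V} {n : ℕ} (h : LP E x y W n) (hn : 2 ≤ n) :
    ∃ (e f M : Finset V) (p q : V) (m : ℕ), e ∈ E ∧ f ∈ E ∧ x ∈ e ∧ p ∈ e ∧ x ≠ p ∧
      y ∈ f ∧ q ∈ f ∧ y ≠ q ∧ LP E p q M m ∧ (∀ z ∈ e, z ∈ M → z = p) ∧
      (∀ z ∈ f, z ∈ M → z = q) ∧ (∀ z ∈ e, z ∈ f → z ∈ M) ∧ W = e ∪ (M ∪ f) := by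
  cases h with
  | nil => omega
  | @cons _ w _ e U n he hx hw hne hz hp =>
    have hr := hp.reverse
    cases hr with
    | nil => omega
    | @cons _ q _ f M n hf hy hq hne2 hz2 hp2 =>
      refine ⟨e, f, M, w, q, n, he, hf, hx, hw, hne, hy, hq, hne2, hp2.reverse, ?_, hz2, ?_, ?_⟩
      · intro z h1 h2
        exact hz z h1 (by simp [h2])
      · intro z h1 h2
        have := hz z h1 (by simp [h2])
        subst this
        exact hp2.right_mem
      · rw [Finset.union_comm M f]

/-- Splitting off a new edge. -/
theorem LP.split {x y : V} {W f : Finset V} {n : ℕ} (h : LP (insert f E) x y W n) :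
    LP E x y W n ∨ ∃ (p q : V) (W1 W2 : Finset V) (n1 n2 : ℕ), p ∈ f ∧ q ∈ f ∧ p ≠ q ∧
      LP E x p W1 n1 ∧ LP E q y W2 n2 ∧ (∀ z ∈ W1, z ∉ W2) ∧ (∀ z ∈ W1, z ∈ f → z = p) ∧
      (∀ z ∈ W2, z ∈ f → z = q) ∧ W1 ⊆ W ∧ W2 ⊆ W ∧ f ⊆ W ∧ n = n1 + n2 + 1 := by
  induction h with
  | nil x => exact Or.inl (LP.nil x)
  | @cons x w y e W n he hx hw hne hz hp ih =>
    rcases ih with ih | ⟨p, q, W1, W2, n1, n2, hp1, hq1, hpq, l1, l2, hd, h1, h2, s1, s2, s3, hn⟩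
    · rcases Finset.mem_insert.1 he with rfl | he
      · right
        refine ⟨x, w, {x}, W, 0, n, hx, hw, hne, LP.nil x, ih, ?_, ?_, ?_, ?_, ?_, ?_, ?_⟩
        · intro z h1 h2; simp at h1; subst h1; exact hne (hz _ hx h2)
        · intro z h1 h2; simpa using h1
        · intro z h1 h2; exact hz z h2 h1
        · simp [hx]
        · exact Finset.subset_union_right
        · exact Finset.subset_union_left
        · omega
      · exact Or.inl (LP.cons he hx hw hne hz ih)
    · rcases Finset.mem_insert.1 he with rfl | he
      · exact absurd ((hz p hp1 (s3 hp1)).trans (hz q hq1 (s3 hq1)).symm) hpq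
      · right
        have hw1 := l1.left_mem
        refine ⟨p, q, e ∪ W1, W2, n1 + 1, n2, hp1, hq1, hpq,
          LP.cons he hx hw hne (fun z a b => hz z a (s1 b)) l1, l2, ?_, ?_, h2, ?_, ?_, ?_, ?_⟩
        · intro z a b
          rcases Finset.mem_union.1 a with a | a
          · have := hz z a (s2 b); subst this; exact hd _ hw1 b
          · exact hd z a b
        · intro z a b
          rcases Finset.mem_union.1 a with a | a
          · have := hz z a (s3 b); subst this; exact h1 _ hw1 b
          · exact h1 z a b
        · exact Finset.union_subset_union_right s1
        · exact s2.trans Finset.subset_union_right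
        · exact s3.trans Finset.subset_union_right
        · omega

/-- A cycle created by a new pair. -/
theorem HasCyc.split {a b : V} (hab : a ≠ b) (h : HasCyc (insert {a, b} E)) :
    HasCyc E ∨ ∃ W n, 2 ≤ n ∧ LP E a b W n := by
  obtain ⟨x, y, W, n, e, hn, hp, he, hx, hy, hz⟩ := h
  have hxy := hp.ne (by omega)
  rcases hp.split with hp' | ⟨p, q, W1, W2, n1, n2, hp1, hq1, hpq, l1, l2, hd, h1, h2, s1, s2, s3, hn'⟩
  · clear hp; rename _ => hp
    rcases Finset.mem_insert.1 he with rfl | he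
    · right
      have : (x = a ∧ y = b) ∨ (x = b ∧ y = a) := by
        simp at hx hy; grind
      rcases this with ⟨rfl, rfl⟩ | ⟨rfl, rfl⟩
      · exact ⟨W, n, hn, hp⟩
      · exact ⟨W, n, hn, hp.reverse⟩
    · exact Or.inl ⟨x, y, W, n, e, hn, hp, he, hx, hy, hz⟩
  · right
    have hx1 := l1.left_mem
    have hy2 := l2.right_mem
    have he : e ∈ E := by
      rcases Finset.mem_insert.1 he with rfl | he
      · exfalso
        have e1 := h1 x hx1 hx
        have e2 := h2 y hy2 hy
        subst e1 e2
        have : n1 = 0 := by by_contra hh; exact l1.ne hh rfl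
        have : n2 = 0 := by by_contra hh; exact l2.ne hh rfl
        omega
      · exact he
    -- q → y → x → p
    have l3 := l2.append (LP.single he hy hx hxy.symm) (by
      intro t a b
      rcases hz t b (s2 a) with rfl | rfl
      · exact absurd a (hd _ hx1)
      · rfl)
    have l4 := l3.append l1 (by
      intro t a b
      rcases Finset.mem_union.1 a with a | a
      · exact absurd a (hd _ b)
      · rcases hz t a (s1 b) with rfl | rfl
        · rfl
        · exact absurd hy2 (hd _ b))
    have : (p = a ∧ q = b) ∨ (p = b ∧ q = a) := by
      simp at hp1 hq1; grind
    rcases this with ⟨rfl, rfl⟩ | ⟨rfl, rfl⟩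
    · exact ⟨_, _, by omega, l4.reverse⟩
    · exact ⟨_, _, by omega, l4⟩

theorem LP.one {x y : V} {W : Finset V} (h : LP E x y W 1) : W ∈ E := by
  cases h with
  | @cons _ w _ e U n he hx hw hne hz hp =>
    cases hp with
    | nil =>
      have h2 : e ∪ {y} = e := by
        ext z; simp only [Finset.mem_union, Finset.mem_singleton]; grind
      rwa [h2]

theorem LP.zero {x y : V} {W : Finset V} (h : LP E x y W 0) : x = y := by
  cases h; rfl

theorem LP.uncons {x y : V} {W : Finset V} {n : ℕ} (h : LP E x y W (n + 1)) :
    ∃ (w : V) (e U : Finset V), e ∈ E ∧ x ∈ e ∧ w ∈ e ∧ x ≠ w ∧ (∀ z ∈ e, z ∈ U → z = w) ∧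
      LP E w y U n ∧ W = e ∪ U := by
  cases h with
  | @cons _ w _ e U n he hx hw hne hz hp => exact ⟨w, e, U, he, hx, hw, hne, hz, hp, rfl⟩

theorem LP.toSeq {x y : V} {W : Finset V} {n : ℕ} (hp : LP E x y W n) :
    ∃ (v : ℕ → V) (h : ℕ → Finset V), v 0 = x ∧ v n = y ∧ (∀ i < n, h i ∈ E ∧ h i ⊆ W) ∧
      (∀ i ≤ n, v i ∈ W) ∧
      (∀ i < n, ∀ j ≤ n, v j ∈ h i ↔ (j = i ∨ j = i + 1)) ∧
      (∀ i j, i < j → j < n → ∀ z ∈ h i, z ∈ h j → j = i + 1 ∧ z = v j) ∧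
      (∀ i j, i < j → j ≤ n → v i ≠ v j) := by
  induction hp with
  | nil x => exact ⟨fun _ => x, fun _ => ∅, rfl, rfl, by simp, by simp, by simp, by simp, by omega⟩
  | @cons x w y e W n he hx hw hne hz hp ih =>
    obtain ⟨v, h, h0, hn, h1, h2, h3, h4, h5⟩ := ih
    have hxW : x ∉ W := fun hh => hne (hz _ hx hh)
    refine ⟨fun i => if i = 0 then x else v (i - 1), fun i => if i = 0 then e else h (i - 1),
      by simp, by simp [hn], ?_, ?_, ?_, ?_, ?_⟩
    · intro i hi
      rcases i with _ | i
      · simp [he]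
      · have := h1 i (by omega)
        simp only [Nat.add_eq_zero_iff, one_ne_zero, and_false, if_false, Nat.add_sub_cancel]
        exact ⟨this.1, this.2.trans Finset.subset_union_right⟩
    · intro i hi
      rcases i with _ | i
      · simp [hx]
      · have := h2 i (by omega)
        simp [this]
    · intro i hi j hj
      rcases i with _ | i <;> rcases j with _ | j
      · simp [hx]
      · simp only [if_true, Nat.add_eq_zero_iff, one_ne_zero, and_false, if_false,
          Nat.add_sub_cancel]
        constructor
        · intro hh
          have := hz _ hh (h2 j (by omega))
          by_contra hc
          exact h5 0 j (by grind) (by omega) (h0.trans this.symm)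
        · intro hh
          have : j = 0 := by simpa using hh
          subst this; rw [h0]; exact hw
      · simp only [if_true, Nat.add_eq_zero_iff, one_ne_zero, and_false, if_false,
          Nat.add_sub_cancel]
        constructor
        · intro hh; exact absurd ((h1 i (by omega)).2 hh) hxW
        · omega
      · simp only [Nat.add_eq_zero_iff, one_ne_zero, and_false, if_false,
          Nat.add_sub_cancel]
        rw [h3 i (by omega) j (by omega)]; omega
    · intro i j hij hj z hzi hzj
      rcases j with _ | j
      · omega
      rcases i with _ | i
      · simp only [if_true, Nat.add_eq_zero_iff, one_ne_zero, and_false, if_false,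
          Nat.add_sub_cancel] at hzi hzj ⊢
        have := hz z hzi ((h1 j (by omega)).2 hzj)
        subst this
        rw [← h0] at hzj
        have := (h3 j (by omega) 0 (by omega)).1 hzj
        have : j = 0 := by omega
        subst this
        simp [h0]
      · simp only [Nat.add_eq_zero_iff, one_ne_zero, and_false, if_false,
          Nat.add_sub_cancel] at hzi hzj ⊢
        have := h4 i j (by omega) (by omega) z hzi hzj
        exact ⟨by omega, this.2⟩
    · intro i j hij hj
      rcases j with _ | j
      · omega
      rcases i with _ | i
      · simp only [if_true, Nat.add_eq_zero_iff, one_ne_zero, and_false, if_false,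
          Nat.add_sub_cancel]
        intro hh
        exact hxW (hh ▸ h2 j (by omega))
      · simp only [Nat.add_eq_zero_iff, one_ne_zero, and_false, if_false,
          Nat.add_sub_cancel]
        exact h5 i j (by omega) (by omega)

theorem HasCyc.toLinear (h3 : ∀ e ∈ E, e.card = 3) (hc : HasCyc E) : HasLinearCycle E := by
  obtain ⟨x, y, W, n, e, hn, hp, he, hx, hy, hz⟩ := hc
  obtain ⟨v, h, h0, hvn, h1, h2, hv, h4, h5⟩ := hp.toSeq
  -- extended edges
  set g : ℕ → Finset V := fun i => if i < n then h i else e with hg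
  have gE : ∀ i, g i ∈ E := by
    intro i; simp only [hg]; split_ifs with hi
    · exact (h1 i hi).1
    · exact he
  have key : ∀ i j, i < j → j ≤ n → ∀ z ∈ g i, z ∈ g j →
      (j = i + 1 ∧ z = v j) ∨ (i = 0 ∧ j = n ∧ z = v 0) := by
    intro i j hij hj z hzi hzj
    simp only [hg] at hzi hzj
    rw [if_pos (by omega)] at hzi
    split_ifs at hzj with hjn
    · exact Or.inl (h4 i j hij hjn z hzi hzj)
    · have hjn : j = n := by omega
      subst hjn
      rcases hz z hzj ((h1 i hij).2 hzi) with hzz | hzz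
      · right
        rw [hzz, ← h0] at hzi
        have := (hv i hij 0 (by omega)).1 hzi
        exact ⟨by omega, rfl, by rw [hzz, h0]⟩
      · left
        rw [hzz, ← hvn] at hzi
        have := (hv i hij j le_rfl).1 hzi
        exact ⟨by omega, by rw [hzz, hvn]⟩
  have mem1 : ∀ i ≤ n, v i ∈ g i := by
    intro i hi; simp only [hg]; split_ifs with hin
    · exact (hv i hin i hi).2 (Or.inl rfl)
    · have : i = n := by omega
      subst this; rw [hvn]; exact hy
  have mem2 : ∀ i < n, v (i + 1) ∈ g i := by
    intro i hi; simp only [hg]; rw [if_pos hi]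
    exact (hv i hi (i + 1) (by omega)).2 (Or.inr rfl)
  have mem3 : v 0 ∈ g n := by
    simp only [hg]; rw [if_neg (by omega), h0]; exact hx
  have ginj : ∀ i j, i < j → j ≤ n → g i ≠ g j := by
    intro i j hij hj heq
    have hsub : g i ⊆ {v j, v 0} := by
      intro z hzi
      rcases key i j hij hj z hzi (heq ▸ hzi) with h | h
      · simp [h.2]
      · simp [h.2.2]
    have := Finset.card_le_card hsub
    have h33 := h3 _ (gE i)
    have : ({v j, v 0} : Finset V).card ≤ 2 := Finset.card_le_two
    omega
  have valsucc : ∀ i : Fin (n + 1), (i + 1).val = if i.val = n then 0 else i.val + 1 := by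
    intro i
    rw [Fin.val_add_one]
    congr 1
    simp [Fin.ext_iff]
  refine ⟨n + 1, fun i : Fin (n + 1) => v i.val, fun i : Fin (n + 1) => g i.val,
    by omega, ?_, ?_, ?_, ?_, ?_⟩
  · intro i j hij
    change Fin (n + 1) at i
    change Fin (n + 1) at j
    simp only at hij
    apply Fin.ext
    by_contra hne
    rcases Nat.lt_or_gt_of_ne hne with hl | hl
    · exact h5 _ _ hl (by omega) hij
    · exact h5 _ _ hl (by omega) hij.symm
  · intro i j hij
    change Fin (n + 1) at i
    change Fin (n + 1) at j
    simp only at hij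
    apply Fin.ext
    by_contra hne
    rcases Nat.lt_or_gt_of_ne hne with hl | hl
    · exact ginj _ _ hl (by omega) hij
    · exact ginj _ _ hl (by omega) hij.symm
  · intro i; exact gE _
  · intro i
    change Fin (n + 1) at i
    have hs : (i + 1 : Fin (n + 1)).val = if i.val = n then 0 else i.val + 1 := valsucc i
    change g i.val ∩ g (i + 1 : Fin (n + 1)).val = {v (i + 1 : Fin (n + 1)).val}
    rw [hs]
    ext z
    simp only [Finset.mem_inter, Finset.mem_singleton]
    split_ifs with hin
    · rw [hin]
      constructor
      · rintro ⟨a, b⟩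
        rcases key 0 n (by omega) le_rfl z b a with h | h
        · omega
        · exact h.2.2
      · rintro rfl
        exact ⟨mem3, mem1 0 (by omega)⟩
    · have hlt := i.isLt
      constructor
      · rintro ⟨a, b⟩
        rcases key i.val (i.val + 1) (by omega) (by omega) z a b with h | h
        · exact h.2
        · omega
      · rintro rfl
        exact ⟨mem2 _ (by omega), mem1 _ (by omega)⟩
  · intro i j hij h1' h2'
    change Fin (n + 1) at i
    change Fin (n + 1) at j
    have hsi : (i + 1 : Fin (n + 1)).val = if i.val = n then 0 else i.val + 1 := valsucc i
    have hsj : (j + 1 : Fin (n + 1)).val = if j.val = n then 0 else j.val + 1 := valsucc j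
    have e1 : i.val ≠ j.val := fun hh => hij (Fin.ext hh)
    have e2 : (i + 1 : Fin (n + 1)).val ≠ j.val := fun hh => h1' (Fin.ext hh)
    have e3 : (j + 1 : Fin (n + 1)).val ≠ i.val := fun hh => h2' (Fin.ext hh)
    rw [hsi] at e2
    rw [hsj] at e3
    change g i.val ∩ g j.val = ∅
    rw [Finset.eq_empty_iff_forall_notMem]
    intro z hzz
    obtain ⟨a, b⟩ := Finset.mem_inter.1 hzz
    have hi := i.isLt
    have hj := j.isLt
    rcases Nat.lt_or_gt_of_ne e1 with hl | hl
    · rcases key _ _ hl (by omega) z a b with h | h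
      · split_ifs at e2 <;> omega
      · split_ifs at e2 e3 <;> omega
    · rcases key _ _ hl (by omega) z b a with h | h
      · split_ifs at e2 e3 <;> omega
      · split_ifs at e2 e3 <;> omega

end paths

def Col {V : Type*} (E : Finset (Finset V)) : Prop :=
  ∃ c : V → Fin 2, ∀ e ∈ E, ∃ x ∈ e, ∃ y ∈ e, c x ≠ c y

def Tr {V : Type*} [DecidableEq V] (E : Finset (Finset V)) (a b c : V) : Prop :=
  {a, b, c} ∈ E ∧ a ≠ b ∧ a ≠ c ∧ b ≠ c

/-- Minimal counterexample. -/
structure MinC {V : Type*} [DecidableEq V] (E : Finset (Finset V)) : Prop where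
  size : ∀ e ∈ E, e.card = 2 ∨ e.card = 3
  cyc : ¬ HasCyc E
  ncol : ¬ Col E
  min : ∀ F : Finset (Finset V), (∀ e ∈ F, e.card = 2 ∨ e.card = 3) → ¬ HasCyc F →
    (∀ e ∈ F, e.card = 3 → e ∈ E) → (∃ e ∈ E, e.card = 3 ∧ e ∉ F) → Col F

section structural
variable {V : Type*} [DecidableEq V] {E F : Finset (Finset V)}

theorem forest_col (E : Finset (Finset V)) : (∀ e ∈ E, e.card = 2) → ¬ HasCyc E → Col E := by
  classical
  induction E using Finset.induction_on with
  | empty => intro _ _; exact ⟨fun _ => 0, by simp⟩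
  | insert e E he ih =>
    intro h2 hc
    obtain ⟨c, hcol⟩ := ih (fun f hf => h2 f (Finset.mem_insert_of_mem hf))
      (fun h => hc (h.mono (Finset.subset_insert _ _)))
    obtain ⟨a, b, hab, rfl⟩ := Finset.card_eq_two.1 (h2 e (Finset.mem_insert_self _ _))
    by_cases hcab : c a = c b
    swap
    · refine ⟨c, fun f hf => ?_⟩
      rcases Finset.mem_insert.1 hf with rfl | hf
      · exact ⟨a, by simp, b, by simp, hcab⟩
      · exact hcol f hf
    have hb : ¬ ∃ W n, LP E a b W n := by
      rintro ⟨W, n, hp⟩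
      have hn := hp.pos hab
      by_cases h1 : n = 1
      · subst h1
        have hW := hp.one
        apply he
        have : {a, b} = W := by
          apply Finset.eq_of_subset_of_card_le
          · intro z hz
            simp only [Finset.mem_insert, Finset.mem_singleton] at hz
            rcases hz with rfl | rfl
            · exact hp.left_mem
            · exact hp.right_mem
          · rw [h2 W (Finset.mem_insert_of_mem hW), Finset.card_pair hab]
        rw [this]; exact hW
      · exact hc ⟨a, b, W, n, {a, b}, by omega, hp.mono (Finset.subset_insert _ _),
          Finset.mem_insert_self _ _, by simp, by simp, by simp⟩
    have hclosed : ∀ x y, {x, y} ∈ E → x ≠ y → (∃ W n, LP E a x W n) → ∃ W n, LP E a y W n := by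
      rintro x y hxy hne ⟨W, n, hp⟩
      by_cases hy : y ∈ W
      · obtain ⟨W1, m, _, h⟩ := hp.trunc hy
        exact ⟨_, _, h⟩
      · refine ⟨_, _, hp.append (LP.single hxy (by simp) (by simp) hne) ?_⟩
        intro t ht ht2
        simp only [Finset.mem_insert, Finset.mem_singleton] at ht2
        rcases ht2 with rfl | rfl
        · rfl
        · exact absurd ht hy
    refine ⟨fun x => if ∃ W n, LP E a x W n then 1 - c x else c x, fun f hf => ?_⟩
    have hflip : ∀ i j : Fin 2, i ≠ j → 1 - i ≠ 1 - j := by decide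
    have hflip2 : ∀ i : Fin 2, 1 - i ≠ i := by decide
    rcases Finset.mem_insert.1 hf with rfl | hf
    · refine ⟨a, by simp, b, by simp, ?_⟩
      beta_reduce
      rw [if_pos (show ∃ W n, LP E a a W n from ⟨_, _, LP.nil a⟩), if_neg hb, hcab]
      exact hflip2 _
    · obtain ⟨x, y, hxy, rfl⟩ := Finset.card_eq_two.1 (h2 f (Finset.mem_insert_of_mem hf))
      have hcxy : c x ≠ c y := by
        obtain ⟨x', hx', y', hy', hne⟩ := hcol _ hf
        simp only [Finset.mem_insert, Finset.mem_singleton] at hx' hy'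
        rcases hx' with rfl | rfl <;> rcases hy' with rfl | rfl
        · exact absurd rfl hne
        · exact hne
        · exact hne.symm
        · exact absurd rfl hne
      refine ⟨x, by simp, y, by simp, ?_⟩
      by_cases hx : ∃ W n, LP E a x W n
      · beta_reduce
        rw [if_pos hx, if_pos (hclosed x y hf hxy hx)]
        exact hflip _ _ hcxy
      · beta_reduce
        rw [if_neg hx, if_neg (fun hy => hx (hclosed y x (by rwa [Finset.pair_comm]) hxy.symm hy))]
        exact hcxy

theorem Tr.rot {a b c : V} (h : Tr E a b c) : Tr E b c a := by
  obtain ⟨h, h1, h2, h3⟩ := h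
  refine ⟨?_, h3, h1.symm, h2.symm⟩
  convert h using 1
  ext z; simp only [Finset.mem_insert, Finset.mem_singleton]; tauto

theorem Tr.swap {a b c : V} (h : Tr E a b c) : Tr E b a c := by
  obtain ⟨h, h1, h2, h3⟩ := h
  refine ⟨?_, h1.symm, h3, h2⟩
  rwa [Finset.insert_comm]

theorem Tr.swap' {a b c : V} (h : Tr E a b c) : Tr E a c b := h.rot.swap.rot.rot

theorem Tr.card {a b c : V} (h : Tr E a b c) : ({a, b, c} : Finset V).card = 3 :=
  Finset.card_eq_three.2 ⟨a, b, c, h.2.1, h.2.2.1, h.2.2.2, rfl⟩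

theorem MinC.p0 (hM : MinC E) {a b c : V} (h : Tr E a b c) : {a, b} ∉ E := by
  intro hab
  apply hM.ncol
  obtain ⟨col, hcol⟩ := hM.min (E.erase {a, b, c}) (fun e he => hM.size e (Finset.mem_of_mem_erase he))
    (fun hc => hM.cyc (hc.mono (Finset.erase_subset _ _)))
    (fun e he _ => Finset.mem_of_mem_erase he) ⟨_, h.1, h.card, by simp⟩
  have hne : ({a, b} : Finset V) ≠ {a, b, c} := by
    intro hh
    have := h.card
    rw [← hh, Finset.card_pair h.2.1] at this
    omega
  refine ⟨col, fun e he => ?_⟩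
  by_cases hee : e = {a, b, c}
  · subst hee
    obtain ⟨x, hx, y, hy, hxy⟩ := hcol _ (Finset.mem_erase.2 ⟨hne, hab⟩)
    simp only [Finset.mem_insert, Finset.mem_singleton] at hx hy
    exact ⟨x, by simp; tauto, y, by simp; tauto, hxy⟩
  · exact hcol e (Finset.mem_erase.2 ⟨hee, he⟩)

theorem tr_of_mem (hM : MinC E) (hFE : F ⊆ E) {e : Finset V} (he : e ∈ F) {a b c : V}
    (ha : a ∈ e) (hb : b ∈ e) (h : Tr E a b c) : ∃ y, Tr F a b y ∧ e = {a, b, y} := by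
  rcases hM.size e (hFE he) with h2 | h3
  · exfalso
    apply hM.p0 h
    have : {a, b} = e := by
      apply Finset.eq_of_subset_of_card_le
      · intro z hz
        simp only [Finset.mem_insert, Finset.mem_singleton] at hz
        rcases hz with rfl | rfl <;> assumption
      · rw [h2, Finset.card_pair h.2.1]
    rw [this]; exact hFE he
  · obtain ⟨x, y, z, hxy, hxz, hyz, rfl⟩ := Finset.card_eq_three.1 h3
    have hab := h.2.1
    simp only [Finset.mem_insert, Finset.mem_singleton] at ha hb
    have hT : Tr F x y z := ⟨he, hxy, hxz, hyz⟩
    rcases ha with rfl | rfl | rfl <;> rcases hb with rfl | rfl | rfl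
    · exact absurd rfl hab
    · exact ⟨z, hT, rfl⟩
    · exact ⟨y, hT.swap', by ext t; simp only [Finset.mem_insert, Finset.mem_singleton]; tauto⟩
    · exact ⟨z, hT.swap, by ext t; simp only [Finset.mem_insert, Finset.mem_singleton]; tauto⟩
    · exact absurd rfl hab
    · exact ⟨x, hT.rot, by ext t; simp only [Finset.mem_insert, Finset.mem_singleton]; tauto⟩
    · exact ⟨y, hT.rot.rot, by ext t; simp only [Finset.mem_insert, Finset.mem_singleton]; tauto⟩
    · exact ⟨x, hT.rot.swap, by ext t; simp only [Finset.mem_insert, Finset.mem_singleton]; tauto⟩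
    · exact absurd rfl hab

theorem cyc_false (hM : MinC E) {x y : V} {W e : Finset V} {n : ℕ} (hn : 2 ≤ n)
    (hp : LP E x y W n) (he : e ∈ E) (hx : x ∈ e) (hy : y ∈ e)
    (hz : ∀ z ∈ e, z ∈ W → z = x ∨ z = y) : False :=
  hM.cyc ⟨x, y, W, n, e, hn, hp, he, hx, hy, hz⟩

theorem cyc_falseT (hM : MinC E) {x y z : V} {W : Finset V} {n : ℕ} (hn : 2 ≤ n)
    (hp : LP E x y W n) (he : Tr E x y z) (hz : z ∉ W) : False := by
  refine cyc_false hM hn hp he.1 (by simp) (by simp) ?_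
  intro t ht htW
  simp only [Finset.mem_insert, Finset.mem_singleton] at ht
  rcases ht with rfl | rfl | rfl
  · exact Or.inl rfl
  · exact Or.inr rfl
  · exact absurd htW hz

theorem kpath (hM : MinC E) (hFE : F ⊆ E) {u v : V} (hF : ∀ e ∈ F, u ∈ e → v ∉ e)
    {W : Finset V} {n : ℕ} (h : LP F u v W n) (hn : 2 ≤ n) :
    ∃ (e f M : Finset V) (p q : V) (m : ℕ), e ∈ F ∧ f ∈ F ∧ u ∈ e ∧ v ∉ e ∧ p ∈ e ∧ u ≠ p ∧
      v ∈ f ∧ u ∉ f ∧ q ∈ f ∧ v ≠ q ∧ LP F p q M m ∧ (∀ z ∈ e, z ∈ M → z = p) ∧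
      (∀ z ∈ f, z ∈ M → z = q) ∧ (∀ z ∈ e, z ∈ f → z ∈ M) ∧ u ∉ M ∧ v ∉ M ∧
      ∀ z, Tr E u v z → (z ∈ e ∨ z ∈ f) ∧ (z ∈ M → z = p ∧ z = q) := by
  obtain ⟨e, f, M, p, q, m, he, hf, hue, hpe, hup, hvf, hqf, hvq, hp, heM, hfM, hef, hW⟩ := h.ends hn
  have hve : v ∉ e := hF e he hue
  have huf : u ∉ f := fun hu => hF f hf hu hvf
  have huM : u ∉ M := fun hu => hup (heM u hue hu)
  have hvM : v ∉ M := fun hv => hvq (hfM v hvf hv)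
  refine ⟨e, f, M, p, q, m, he, hf, hue, hve, hpe, hup, hvf, huf, hqf, hvq, hp, heM, hfM, hef,
    huM, hvM, ?_⟩
  intro z hz
  have hzM : z ∈ M → z = p ∧ z = q := by
    intro hzM
    constructor
    · by_contra hzp
      obtain ⟨M1, m1, hs, hp1⟩ := hp.trunc hzM
      have hm1 := hp1.pos (Ne.symm hzp)
      have hp2 := LP.cons he hue hpe hup (fun t a b => heM t a (hs b)) hp1
      refine cyc_falseT hM (by omega) (hp2.mono hFE) hz.swap' ?_
      rw [Finset.mem_union]; rintro (h | h)
      · exact hve h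
      · exact hvM (hs h)
    · by_contra hzq
      obtain ⟨M1, m1, hs, hp1⟩ := hp.reverse.trunc hzM
      have hm1 := hp1.pos (Ne.symm hzq)
      have hp2 := LP.cons hf hvf hqf hvq (fun t a b => hfM t a (hs b)) hp1
      refine cyc_falseT hM (by omega) (hp2.mono hFE) hz.rot ?_
      rw [Finset.mem_union]; rintro (h | h)
      · exact huf h
      · exact huM (hs h)
  refine ⟨?_, hzM⟩
  by_contra hcon
  push Not at hcon
  by_cases hzMm : z ∈ M
  · exact hcon.1 ((hzM hzMm).1 ▸ hpe)
  · refine cyc_falseT hM hn (h.mono hFE) hz ?_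
    rw [hW]; simp [hcon, hzMm]

theorem lemY (hM : MinC E) {u v s t p y : V} {e U : Finset V} {m : ℕ} (huvt : Tr E u v t)
    (he : e ∈ E) (hs : s ∈ e) (hp : p ∈ e) (hsp : s ≠ p) (hU : LP E p t U m) (hm : 1 ≤ m)
    (heU : ∀ z ∈ e, z ∈ U → z = p) (hue : u ∉ e) (huU : u ∉ U) (hve : v ∉ e) (hvU : v ∉ U)
    (hy : Tr E u s y) (hyv : y ≠ v) : y ∈ e ∧ y ∉ U := by
  have htU := hU.right_mem
  have hsU : s ∉ U := fun h => hsp (heU s hs h)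
  have hyU : y ∉ U := by
    intro hyU
    by_cases hyp : y = p
    · subst hyp
      have h1 := hU.append (LP.single huvt.1 (x := t) (y := u) (by simp) (by simp) huvt.2.2.1.symm)
        (by
          intro z a b
          simp only [Finset.mem_insert, Finset.mem_singleton] at b
          rcases b with rfl | rfl | rfl
          · exact absurd a huU
          · exact absurd a hvU
          · rfl)
      refine cyc_falseT hM (by omega) h1 hy.rot.rot ?_
      simp only [Finset.mem_union, Finset.mem_insert, Finset.mem_singleton]
      rintro (h | rfl | rfl | rfl)
      · exact hsU h
      · exact hue hs
      · exact hve hs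
      · exact hsU htU
    · obtain ⟨M1, m1, hss, hp1⟩ := hU.trunc hyU
      have hm1 := hp1.pos (Ne.symm hyp)
      have hp2 := LP.cons he hs hp hsp (fun t a b => heU t a (hss b)) hp1
      refine cyc_falseT hM (by omega) hp2 hy.rot ?_
      rw [Finset.mem_union]; rintro (h | h)
      · exact hue h
      · exact huU (hss h)
  refine ⟨?_, hyU⟩
  by_contra hye
  have h0 := LP.cons he hs hp hsp heU hU
  have h1 := h0.append (LP.single huvt.1 (x := t) (y := u) (by simp) (by simp) huvt.2.2.1.symm)
        (by
          intro z a b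
          simp only [Finset.mem_insert, Finset.mem_singleton] at b
          rcases b with rfl | rfl | rfl
          · simp [hue, huU] at a
          · simp [hve, hvU] at a
          · rfl)
  refine cyc_falseT hM (by omega) h1 hy.swap ?_
  simp only [Finset.mem_union, Finset.mem_insert, Finset.mem_singleton]
  have := hy.2.2.1
  rintro ((h | h) | rfl | rfl | rfl)
  · exact hye h
  · exact hyU h
  · exact this rfl
  · exact hyv rfl
  · exact hyU htU

theorem lemK (hM : MinC E) (hFE : F ⊆ E) {u v s : V} (hF : ∀ e ∈ F, u ∈ e → v ∉ e)
    {W : Finset V} {n : ℕ} (h : LP F u v W n) (hn : 2 ≤ n) (hs : Tr E u v s) :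
    ∃ y, Tr F u s y ∨ Tr F v s y := by
  obtain ⟨e, f, M, p, q, m, he, hf, hue, hve, hpe, hup, hvf, huf, hqf, hvq, hp, heM, hfM, hef,
    huM, hvM, hz⟩ := kpath hM hFE hF h hn
  rcases (hz s hs).1 with h | h
  · obtain ⟨y, hy, _⟩ := tr_of_mem hM hFE he hue h hs.swap'
    exact ⟨y, Or.inl hy⟩
  · obtain ⟨y, hy, _⟩ := tr_of_mem hM hFE hf hvf h hs.rot
    exact ⟨y, Or.inr hy⟩

theorem col_mono_of (hM : MinC E) (hFc : Col F) (h : ∀ e ∈ E, ∃ f ∈ F, f ⊆ e) : False := by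
  obtain ⟨c, hc⟩ := hFc
  apply hM.ncol
  refine ⟨c, fun e he => ?_⟩
  obtain ⟨f, hf, hfe⟩ := h e he
  obtain ⟨x, hx, y, hy, hxy⟩ := hc f hf
  exact ⟨x, hfe hx, y, hfe hy, hxy⟩

theorem conv (hM : MinC E) {a b c : V} (h : Tr E a b c) :
    ∃ W n, 2 ≤ n ∧ LP (E.filter (fun e => ¬ (a ∈ e ∧ b ∈ e))) a b W n := by
  by_contra hcon
  set F := E.filter (fun e => ¬ (a ∈ e ∧ b ∈ e)) with hF
  have hFE : F ⊆ E := Finset.filter_subset _ _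
  have hcol : Col (insert {a, b} F) := by
    apply hM.min
    · intro e he
      rcases Finset.mem_insert.1 he with rfl | he
      · exact Or.inl (Finset.card_pair h.2.1)
      · exact hM.size e (hFE he)
    · intro hc
      rcases hc.split h.2.1 with hc | hc
      · exact hM.cyc (hc.mono hFE)
      · exact hcon hc
    · intro e he h3
      rcases Finset.mem_insert.1 he with rfl | he
      · rw [Finset.card_pair h.2.1] at h3; omega
      · exact hFE he
    · refine ⟨_, h.1, h.card, ?_⟩
      intro hm
      rcases Finset.mem_insert.1 hm with hm | hm
      · have := h.card
        rw [hm, Finset.card_pair h.2.1] at this; omega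
      · simp [hF] at hm
  refine col_mono_of hM hcol ?_
  intro e he
  by_cases hh : a ∈ e ∧ b ∈ e
  · exact ⟨{a, b}, by simp, by
      intro z hz; simp only [Finset.mem_insert, Finset.mem_singleton] at hz
      rcases hz with rfl | rfl
      · exact hh.1
      · exact hh.2⟩
  · exact ⟨e, Finset.mem_insert_of_mem (Finset.mem_filter.2 ⟨he, hh⟩), subset_rfl⟩

/-- Main reduction: no quasi-cycles with a long path. Here `y` is given. -/
theorem quasi_aux (hM : MinC E) {u v s t p y : V} {e U : Finset V} {m : ℕ} (huvs : Tr E u v s)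
    (huvt : Tr E u v t)
    (he : e ∈ E) (hs : s ∈ e) (hp : p ∈ e) (hsp : s ≠ p) (hU : LP E p t U m) (hm : 1 ≤ m)
    (heU : ∀ z ∈ e, z ∈ U → z = p) (hue : u ∉ e) (huU : u ∉ U) (hve : v ∉ e) (hvU : v ∉ U)
    (hy : Tr E u s y) (hyv : y ≠ v) : False := by
  obtain ⟨hye, hyU⟩ := lemY hM huvt he hs hp hsp hU hm heU hue huU hve hvU hy hyv
  have hsU : s ∉ U := fun h => hsp (heU s hs h)
  have htU := hU.right_mem
  have hpU := hU.left_mem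
  have hpy : y ≠ p := fun h => hyU (h ▸ hpU)
  have hsy : s ≠ y := hy.2.2.2
  -- the edge e is {s, y, p}
  have heq : ∀ z ∈ e, z = s ∨ z = y ∨ z = p := by
    have hsub : ({s, y, p} : Finset V) ⊆ e := by
      intro z hz; simp only [Finset.mem_insert, Finset.mem_singleton] at hz
      rcases hz with rfl | rfl | rfl <;> assumption
    have hc : ({s, y, p} : Finset V).card = 3 := Finset.card_eq_three.2 ⟨s, y, p, hsy, hsp, hpy, rfl⟩
    have : ({s, y, p} : Finset V) = e := by
      apply Finset.eq_of_subset_of_card_le hsub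
      rcases hM.size e he with h | h <;> omega
    intro z hz
    rw [← this] at hz
    simpa using hz
  have hesyp : e = {s, y, p} := by
    ext z; simp only [Finset.mem_insert, Finset.mem_singleton]
    constructor
    · exact heq z
    · rintro (rfl | rfl | rfl) <;> assumption
  have hsyp : Tr E s y p := ⟨hesyp ▸ he, hsy, hsp, hpy⟩
  -- uniqueness of y
  have uniq1 : ∀ α, Tr E u s α → α ≠ v → α = y := by
    intro α h1 h2
    obtain ⟨ha, hb⟩ := lemY hM huvt he hs hp hsp hU hm heU hue huU hve hvU h1 h2
    rcases heq α ha with rfl | rfl | rfl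
    · exact absurd rfl h1.2.2.2
    · rfl
    · exact absurd hpU hb
  have uniq2 : ∀ α, Tr E v s α → α ≠ u → α = y := by
    intro α h1 h2
    obtain ⟨ha, hb⟩ := lemY hM huvt.swap he hs hp hsp hU hm heU hve hvU hue huU h1 h2
    rcases heq α ha with rfl | rfl | rfl
    · exact absurd rfl h1.2.2.2
    · rfl
    · exact absurd hpU hb
  have hyu : y ≠ u := hy.2.2.1.symm
  have hyt : y ≠ t := fun h => hyU (h ▸ htU)
  have hst : s ≠ t := fun h => hsU (h ▸ htU)
  -- the rotated quasi-cycle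
  have uniq3 : ∀ α, Tr E s u α → α ≠ y → α = v := by
    intro α h1 h2
    obtain ⟨ha, hb⟩ := lemY hM (u := s) (v := y) (s := u) (t := p) (p := t) hsyp huvt.1 (by simp)
      (by simp) huvt.2.2.1 hU.reverse hm (by
        intro z a b
        simp only [Finset.mem_insert, Finset.mem_singleton] at a
        rcases a with rfl | rfl | rfl
        · exact absurd b huU
        · exact absurd b hvU
        · rfl)
      (by simp [huvs.2.2.1.symm, huvs.2.2.2.symm, hst]) hsU (by simp [hyu, hyv, hyt]) hyU h1 h2
    simp only [Finset.mem_insert, Finset.mem_singleton] at ha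
    rcases ha with rfl | rfl | rfl
    · exact absurd rfl h1.2.2.2
    · rfl
    · exact absurd htU hb
  have uniq4 : ∀ α, Tr E y u α → α ≠ s → α = v := by
    intro α h1 h2
    obtain ⟨ha, hb⟩ := lemY hM (u := y) (v := s) (s := u) (t := p) (p := t) hsyp.swap huvt.1 (by simp)
      (by simp) huvt.2.2.1 hU.reverse hm (by
        intro z a b
        simp only [Finset.mem_insert, Finset.mem_singleton] at a
        rcases a with rfl | rfl | rfl
        · exact absurd b huU
        · exact absurd b hvU
        · rfl)
      (by simp [hyu, hyv, hyt]) hyU (by simp [huvs.2.2.1.symm, huvs.2.2.2.symm, hst]) hsU h1 h2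
    simp only [Finset.mem_insert, Finset.mem_singleton] at ha
    rcases ha with rfl | rfl | rfl
    · exact absurd rfl h1.2.2.2
    · rfl
    · exact absurd htU hb
  -- simultaneous conversion
  set F := E.filter (fun g => ¬ (u ∈ g ∧ v ∈ g) ∧ ¬ (s ∈ g ∧ y ∈ g)) with hF
  have hFE : F ⊆ E := Finset.filter_subset _ _
  have hF1 : ∀ g ∈ F, u ∈ g → v ∉ g := by
    intro g hg h1 h2; exact (Finset.mem_filter.1 hg).2.1 ⟨h1, h2⟩
  have hF2 : ∀ g ∈ F, s ∈ g → y ∉ g := by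
    intro g hg h1 h2; exact (Finset.mem_filter.1 hg).2.2 ⟨h1, h2⟩
  have hTE : ∀ {a b c : V}, Tr F a b c → Tr E a b c := fun h => ⟨hFE h.1, h.2⟩
  have no1 : ¬ ∃ W n, 2 ≤ n ∧ LP F u v W n := by
    rintro ⟨W, n, hn, hp⟩
    obtain ⟨α, h | h⟩ := lemK hM hFE hF1 hp hn huvs
    · have hav : α ≠ v := by
        rintro rfl; exact hF1 _ h.1 (by simp) (by simp)
      have := uniq1 α (hTE h) hav
      subst this
      exact hF2 _ h.1 (by simp) (by simp)
    · have hav : α ≠ u := by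
        rintro rfl; exact hF1 _ h.1 (by simp) (by simp)
      have := uniq2 α (hTE h) hav
      subst this
      exact hF2 _ h.1 (by simp) (by simp)
  have no2 : ¬ ∃ W n, 2 ≤ n ∧ LP F s y W n := by
    rintro ⟨W, n, hn, hp⟩
    obtain ⟨α, h | h⟩ := lemK hM hFE hF2 hp hn hy.rot
    · have hav : α ≠ y := by
        rintro rfl; exact hF2 _ h.1 (by simp) (by simp)
      have := uniq3 α (hTE h) hav
      subst this
      exact hF1 _ h.1 (by simp) (by simp)
    · have hav : α ≠ s := by
        rintro rfl; exact hF2 _ h.1 (by simp) (by simp)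
      have := uniq4 α (hTE h) hav
      subst this
      exact hF1 _ h.1 (by simp) (by simp)
  have no3 : ∀ W n, LP F s u W n → v ∉ W → y ∉ W → False := by
    intro W n hp hv hyW
    have hn := hp.pos huvs.2.2.1.symm
    by_cases h1 : n = 1
    · subst h1
      obtain ⟨α, h, hWe⟩ := tr_of_mem hM hFE hp.one hp.right_mem hp.left_mem hy
      have hav : α ≠ v := by
        rintro rfl; exact hv (by simp [hWe])
      have := uniq1 α (hTE h) hav
      subst this
      exact hyW (by simp [hWe])
    · exact cyc_falseT hM (by omega) (hp.mono hFE) huvs.rot.rot hv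
  have no4 : ∀ W n, LP F s v W n → u ∉ W → y ∉ W → False := by
    intro W n hp hv hyW
    have hn := hp.pos huvs.2.2.2.symm
    by_cases h1 : n = 1
    · subst h1
      obtain ⟨α, h, hWe⟩ := tr_of_mem hM hFE hp.one hp.right_mem hp.left_mem huvs.rot
      have hav : α ≠ u := by
        rintro rfl; exact hv (by simp [hWe])
      have := uniq2 α (hTE h) hav
      subst this
      exact hyW (by simp [hWe])
    · exact cyc_falseT hM (by omega) (hp.mono hFE) huvs.rot.swap hv
  have huv := huvs.2.1
  have hcol : Col (insert {s, y} (insert {u, v} F)) := by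
    apply hM.min
    · intro g hg
      simp only [Finset.mem_insert] at hg
      rcases hg with rfl | rfl | hg
      · exact Or.inl (Finset.card_pair hsy)
      · exact Or.inl (Finset.card_pair huv)
      · exact hM.size g (hFE hg)
    · intro hc
      rcases hc.split hsy with hc | ⟨W, n, hn, hp⟩
      · rcases hc.split huv with hc | hc
        · exact hM.cyc (hc.mono hFE)
        · exact no1 hc
      · rcases hp.split with hp | ⟨a, b, W1, W2, n1, n2, ha, hb, hab, l1, l2, hd, -⟩
        · exact no2 ⟨W, n, hn, hp⟩
        · have hyW : y ∉ W1 := fun h => hd _ h l2.right_mem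
          have hbW : b ∉ W1 := fun h => hd _ h l2.left_mem
          simp only [Finset.mem_insert, Finset.mem_singleton] at ha hb
          rcases ha with rfl | rfl <;> rcases hb with rfl | rfl
          · exact hab rfl
          · exact no3 _ _ l1 hbW hyW
          · exact no4 _ _ l1 hbW hyW
          · exact hab rfl
    · intro g hg h3
      simp only [Finset.mem_insert] at hg
      rcases hg with rfl | rfl | hg
      · rw [Finset.card_pair hsy] at h3; omega
      · rw [Finset.card_pair huv] at h3; omega
      · exact hFE hg
    · refine ⟨_, huvs.1, huvs.card, ?_⟩
      intro hm
      have hcc := huvs.card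
      simp only [Finset.mem_insert] at hm
      rcases hm with hm | hm | hm
      · rw [hm, Finset.card_pair hsy] at hcc; omega
      · rw [hm, Finset.card_pair huv] at hcc; omega
      · exact hF1 _ hm (by simp) (by simp)
  refine col_mono_of hM hcol ?_
  intro g hg
  by_cases h1 : u ∈ g ∧ v ∈ g
  · exact ⟨{u, v}, by simp, by
      intro z hz; simp only [Finset.mem_insert, Finset.mem_singleton] at hz
      rcases hz with rfl | rfl
      · exact h1.1
      · exact h1.2⟩
  by_cases h2 : s ∈ g ∧ y ∈ g
  · exact ⟨{s, y}, by simp, by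
      intro z hz; simp only [Finset.mem_insert, Finset.mem_singleton] at hz
      rcases hz with rfl | rfl
      · exact h2.1
      · exact h2.2⟩
  · exact ⟨g, by simp only [Finset.mem_insert]; exact Or.inr (Or.inr (Finset.mem_filter.2 ⟨hg, h1, h2⟩)),
      subset_rfl⟩

theorem quasi (hM : MinC E) {u v s t : V} {Q : Finset V} {n : ℕ} (huvs : Tr E u v s)
    (huvt : Tr E u v t) (hQ : LP E s t Q n) (hn : 2 ≤ n) (hu : u ∉ Q) (hv : v ∉ Q) : False := by
  obtain ⟨n, rfl⟩ : ∃ k, n = k + 1 := ⟨n - 1, by omega⟩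
  obtain ⟨p, e, U, he, hs, hp, hsp, heU, hU, rfl⟩ := hQ.uncons
  simp only [Finset.mem_union, not_or] at hu hv
  obtain ⟨W, l, hl, hK⟩ := conv hM huvs
  have hF : ∀ g ∈ E.filter (fun g => ¬ (u ∈ g ∧ v ∈ g)), u ∈ g → v ∉ g := by
    intro g hg h1 h2; exact (Finset.mem_filter.1 hg).2 ⟨h1, h2⟩
  have hFE : E.filter (fun g => ¬ (u ∈ g ∧ v ∈ g)) ⊆ E := Finset.filter_subset _ _
  obtain ⟨y, h | h⟩ := lemK hM hFE hF hK hl huvs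
  · exact quasi_aux hM huvs huvt he hs hp hsp hU (by omega) heU hu.1 hu.2 hv.1 hv.2
      ⟨hFE h.1, h.2⟩ (by rintro rfl; exact hF _ h.1 (by simp) (by simp))
  · exact quasi_aux hM huvs.swap huvt.swap he hs hp hsp hU (by omega) heU hv.1 hv.2 hu.1 hu.2
      ⟨hFE h.1, h.2⟩ (by rintro rfl; exact hF _ h.1 (by simp) (by simp))

end structural

section local_analysis
variable {V : Type*} [DecidableEq V] {E F : Finset (Finset V)}

/-- Type II configuration. -/
def CfgII (E : Finset (Finset V)) (u v s t : V) (g : Finset V) : Prop :=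
  Tr E u v s ∧ Tr E u v t ∧ s ≠ t ∧ g ∈ E ∧ s ∈ g ∧ t ∈ g ∧ u ∉ g ∧ v ∉ g

theorem Tr.mono {a b c : V} (h : Tr F a b c) (hFE : F ⊆ E) : Tr E a b c := ⟨hFE h.1, h.2⟩

theorem tr_of_three (hM : MinC E) {g : Finset V} (hg : g ∈ E) {a b c : V} (ha : a ∈ g)
    (hb : b ∈ g) (hc : c ∈ g) (h1 : a ≠ b) (h2 : a ≠ c) (h3 : b ≠ c) : Tr E a b c := by
  refine ⟨?_, h1, h2, h3⟩
  have hcard : ({a, b, c} : Finset V).card = 3 := Finset.card_eq_three.2 ⟨a, b, c, h1, h2, h3, rfl⟩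
  have : {a, b, c} = g := by
    apply Finset.eq_of_subset_of_card_le
    · intro z hz
      simp only [Finset.mem_insert, Finset.mem_singleton] at hz
      rcases hz with rfl | rfl | rfl <;> assumption
    · rcases hM.size g hg with h | h <;> omega
  rw [this]; exact hg

theorem tri_edges (hM : MinC E) {a b c : V} {e1 e2 e3 : Finset V} (h1 : e1 ∈ E) (h2 : e2 ∈ E)
    (h3 : e3 ∈ E) (a1 : a ∈ e1) (b1 : b ∈ e1) (b2 : b ∈ e2) (c2 : c ∈ e2) (c3 : c ∈ e3)
    (a3 : a ∈ e3) (hab : a ≠ b) (hbc : b ≠ c) (i12 : ∀ z ∈ e1, z ∈ e2 → z = b)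
    (i13 : ∀ z ∈ e3, z ∈ e1 → z = a) (i23 : ∀ z ∈ e3, z ∈ e2 → z = c) : False := by
  have hp := (LP.single h1 a1 b1 hab).append (LP.single h2 b2 c2 hbc) i12
  refine cyc_false hM (by omega) hp h3 a3 c3 ?_
  intro z hz hz2
  rcases Finset.mem_union.1 hz2 with h | h
  · exact Or.inl (i13 z hz h)
  · exact Or.inr (i23 z hz h)

theorem tri_false (hM : MinC E) {a b c p q r : V} (h1 : Tr E a b p) (h2 : Tr E b c q)
    (h3 : Tr E c a r) (hpc : p ≠ c) (hqa : q ≠ a) (hrb : r ≠ b) (hpq : p ≠ q) (hqr : q ≠ r)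
    (hpr : p ≠ r) : False := by
  obtain ⟨g1, n1, n2, n3⟩ := h1
  obtain ⟨g2, m1, m2, m3⟩ := h2
  obtain ⟨g3, k1, k2, k3⟩ := h3
  refine tri_edges hM (a := a) (b := b) (c := c) g1 g2 g3 (by simp) (by simp) (by simp) (by simp)
    (by simp) (by simp) n1 m1 ?_ ?_ ?_
  all_goals
    intro z
    simp only [Finset.mem_insert, Finset.mem_singleton]
    grind

theorem f3 (hM : MinC E) {a b c : V} (h : Tr E a b c) :
    (∃ p r, Tr E a c p ∧ Tr E b c r ∧ p ≠ r ∧ p ≠ b ∧ r ≠ a) ∨ ∃ u v s t g, CfgII E u v s t g := by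
  obtain ⟨W, l, hl, hK⟩ := conv hM h
  have hF : ∀ g ∈ E.filter (fun g => ¬ (a ∈ g ∧ b ∈ g)), a ∈ g → b ∉ g := by
    intro g hg h1 h2; exact (Finset.mem_filter.1 hg).2 ⟨h1, h2⟩
  have hFE : E.filter (fun g => ¬ (a ∈ g ∧ b ∈ g)) ⊆ E := Finset.filter_subset _ _
  obtain ⟨e, f, M, p, q, m, he, hf, hue, hve, hpe, hup, hvf, huf, hqf, hvq, hp, heM, hfM, hef,
    huM, hvM, hz⟩ := kpath hM hFE hF hK hl
  obtain ⟨hzef, hzM⟩ := hz c h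
  by_cases hcM : c ∈ M
  · left
    obtain ⟨h1, h2⟩ := hzM hcM
    have hce : c ∈ e := h1 ▸ hpe
    have hcf : c ∈ f := h2 ▸ hqf
    obtain ⟨x, hx, hxe⟩ := tr_of_mem hM hFE he hue hce h.swap'
    obtain ⟨y, hy, hyf⟩ := tr_of_mem hM hFE hf hvf hcf h.rot
    have hxe' : x ∈ e := by simp [hxe]
    have hyf' : y ∈ f := by simp [hyf]
    refine ⟨x, y, hx.mono hFE, hy.mono hFE, ?_, ?_, ?_⟩
    · rintro rfl
      exact hx.2.2.2 (h1.trans (heM x hxe' (hef x hxe' hyf')).symm)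
    · rintro rfl; exact hve hxe'
    · rintro rfl; exact huf hyf'
  · right
    have hpM := hp.left_mem
    have hqM := hp.right_mem
    rcases hzef with hce | hcf
    · have hcf : c ∉ f := fun hc => hcM (hef c hce hc)
      obtain ⟨x, hx, hxe⟩ := tr_of_mem hM hFE he hue hce h.swap'
      have hpx : p = x := by
        rw [hxe] at hpe
        simp only [Finset.mem_insert, Finset.mem_singleton] at hpe
        rcases hpe with rfl | rfl | rfl
        · exact absurd rfl hup
        · exact absurd hpM hcM
        · rfl
      subst hpx
      have hm : m = 0 := by
        by_contra hm
        have hpath := hp.append (LP.single hf hqf hvf hvq.symm) (fun z h1 h2 => hfM z h2 h1)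
        exact quasi hM (hx.mono hFE) h.swap' (hpath.mono hFE) (by omega)
          (by simp [huM, huf]) (by simp [hcM, hcf])
      subst hm
      have hpq := hp.zero
      exact ⟨a, c, b, p, f, h.swap', hx.mono hFE, fun hh => hve (hh ▸ hpe), hFE hf, hvf,
        hpq ▸ hqf, huf, hcf⟩
    · have hce : c ∉ e := fun hc => hcM (hef c hc hcf)
      obtain ⟨x, hx, hxe⟩ := tr_of_mem hM hFE hf hvf hcf h.rot
      have hpx : q = x := by
        rw [hxe] at hqf
        simp only [Finset.mem_insert, Finset.mem_singleton] at hqf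
        rcases hqf with rfl | rfl | rfl
        · exact absurd rfl hvq
        · exact absurd hqM hcM
        · rfl
      subst hpx
      have hm : m = 0 := by
        by_contra hm
        have hpath := hp.reverse.append (LP.single he hpe hue hup.symm) (fun z h1 h2 => heM z h2 h1)
        exact quasi hM (hx.mono hFE) h.rot (hpath.mono hFE) (by omega)
          (by simp [hvM, hve]) (by simp [hcM, hce])
      subst hm
      have hpq := hp.zero
      exact ⟨b, c, a, q, e, h.rot, hx.mono hFE, fun hh => huf (hh ▸ hqf), hFE he, hue,
        hpq ▸ hpe, hve, hce⟩

theorem f4_aux (hM : MinC E) (hFE : F ⊆ E) {u v s t p q : V} {e f M : Finset V} {m : ℕ}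
    (hs : Tr E u v s) (ht : Tr E u v t) (he : e ∈ F) (hf : f ∈ F)
    (hue : u ∈ e) (hve : v ∉ e) (hpe : p ∈ e) (hup : u ≠ p) (hvf : v ∈ f) (huf : u ∉ f)
    (hqf : q ∈ f) (hvq : v ≠ q) (hp : LP F p q M m) (hfM : ∀ z ∈ f, z ∈ M → z = q)
    (huM : u ∉ M)
    (hzs : s ∈ M → s = p ∧ s = q) (hzt : t ∈ M → t = p ∧ t = q)
    (hse : s ∈ e) (htf : t ∈ f) (hsf : s ∉ f) (hte : t ∉ e) :
    ∃ y, y ≠ u ∧ y ≠ v ∧ y ≠ s ∧ y ≠ t ∧ Tr E u s y ∧ Tr E v t y := by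
  have hsM : s ∉ M := fun h => hsf ((hzs h).2 ▸ hqf)
  have htM : t ∉ M := fun h => hte ((hzt h).1 ▸ hpe)
  obtain ⟨y, hy, hye⟩ := tr_of_mem hM hFE he hue hse hs.swap'
  obtain ⟨y', hy', hyf⟩ := tr_of_mem hM hFE hf hvf htf ht.rot
  have hpy : p = y := by
    rw [hye] at hpe
    simp only [Finset.mem_insert, Finset.mem_singleton] at hpe
    rcases hpe with rfl | rfl | rfl
    · exact absurd rfl hup
    · exact absurd hp.left_mem hsM
    · rfl
  have hqy : q = y' := by
    rw [hyf] at hqf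
    simp only [Finset.mem_insert, Finset.mem_singleton] at hqf
    rcases hqf with rfl | rfl | rfl
    · exact absurd rfl hvq
    · exact absurd hp.right_mem htM
    · rfl
  subst hpy hqy
  have hpq : p = q := by
    by_contra hpq
    have hm := hp.pos hpq
    have hpath := hp.append (LP.single hf hqf hvf hvq.symm) (fun z h1 h2 => hfM z h2 h1)
    exact quasi hM (hy.mono hFE) hs.swap' (hpath.mono hFE) (by omega)
      (by simp [huM, huf]) (by simp [hsM, hsf])
  subst hpq
  exact ⟨p, hup.symm, hvq.symm, hy.2.2.2.symm, hy'.2.2.2.symm, hy.mono hFE, hy'.mono hFE⟩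

theorem f4_aux2 (hM : MinC E) (hFE : F ⊆ E) {u v s t p q : V} {e f M : Finset V} {m : ℕ}
    (hs : Tr E u v s) (ht : Tr E u v t) (hst : s ≠ t) (he : e ∈ F) (hf : f ∈ F)
    (hue : u ∈ e) (hpe : p ∈ e) (hup : u ≠ p) (hvf : v ∈ f) (huf : u ∉ f)
    (hqf : q ∈ f) (hp : LP F p q M m) (heM : ∀ z ∈ e, z ∈ M → z = p)
    (hef : ∀ z ∈ e, z ∈ f → z ∈ M)
    (hzs : s ∈ M → s = p ∧ s = q) (hzt : t ∈ M → t = p ∧ t = q)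
    (hse : s ∈ e) (hte : t ∈ e) :
    Tr E u s t ∧ ∃ o, o ≠ u ∧ o ≠ v ∧ o ≠ s ∧ o ≠ t ∧ (Tr E v s o ∨ Tr E v t o) := by
  have hust : Tr E u s t := tr_of_three hM (hFE he) hue hse hte hs.2.2.1 ht.2.2.1 hst
  have hee : p = s ∨ p = t := by
    obtain ⟨y, hy, hye⟩ := tr_of_mem hM hFE he hue hse hs.swap'
    rw [hye] at hte hpe
    simp only [Finset.mem_insert, Finset.mem_singleton] at hte hpe
    rcases hte with h | h | h
    · exact absurd h.symm ht.2.2.1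
    · exact absurd h.symm hst
    · subst h
      rcases hpe with h | h | h
      · exact absurd h.symm hup
      · exact Or.inl h
      · exact Or.inr h
  refine ⟨hust, ?_⟩
  rcases hee with rfl | rfl
  · have hpq := (hzs hp.left_mem).2
    subst hpq
    obtain ⟨o, ho, hof⟩ := tr_of_mem hM hFE hf hvf hqf hs.rot
    have hof' : o ∈ f := by simp [hof]
    refine ⟨o, ?_, ho.2.2.1.symm, ho.2.2.2.symm, ?_, Or.inl (ho.mono hFE)⟩
    · rintro rfl; exact huf hof'
    · rintro rfl; exact hst (heM o hte (hef o hte hof')).symm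
  · have hpq := (hzt hp.left_mem).2
    subst hpq
    obtain ⟨o, ho, hof⟩ := tr_of_mem hM hFE hf hvf hqf ht.rot
    have hof' : o ∈ f := by simp [hof]
    refine ⟨o, ?_, ho.2.2.1.symm, ?_, ho.2.2.2.symm, Or.inr (ho.mono hFE)⟩
    · rintro rfl; exact huf hof'
    · rintro rfl; exact hst (heM o hse (hef o hse hof'))

theorem f4 (hM : MinC E) {u v s t : V} (hs : Tr E u v s) (ht : Tr E u v t) (hst : s ≠ t) :
    (∃ y, y ≠ u ∧ y ≠ v ∧ y ≠ s ∧ y ≠ t ∧ ((Tr E u s y ∧ Tr E v t y) ∨ (Tr E v s y ∧ Tr E u t y))) ∨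
    (Tr E u s t ∧ ∃ o, o ≠ u ∧ o ≠ v ∧ o ≠ s ∧ o ≠ t ∧ (Tr E v s o ∨ Tr E v t o)) ∨
    (Tr E v s t ∧ ∃ o, o ≠ u ∧ o ≠ v ∧ o ≠ s ∧ o ≠ t ∧ (Tr E u s o ∨ Tr E u t o)) := by
  obtain ⟨W, l, hl, hK⟩ := conv hM hs
  have hF : ∀ g ∈ E.filter (fun g => ¬ (u ∈ g ∧ v ∈ g)), u ∈ g → v ∉ g := by
    intro g hg h1 h2; exact (Finset.mem_filter.1 hg).2 ⟨h1, h2⟩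
  have hFE : E.filter (fun g => ¬ (u ∈ g ∧ v ∈ g)) ⊆ E := Finset.filter_subset _ _
  obtain ⟨e, f, M, p, q, m, he, hf, hue, hve, hpe, hup, hvf, huf, hqf, hvq, hp, heM, hfM, hef,
    huM, hvM, hz⟩ := kpath hM hFE hF hK hl
  obtain ⟨s1, s2⟩ := hz s hs
  obtain ⟨t1, t2⟩ := hz t ht
  by_cases c1 : s ∈ e ∧ t ∈ e
  · exact Or.inr (Or.inl (f4_aux2 hM hFE hs ht hst he hf hue hpe hup hvf huf hqf hp heM hef s2 t2
      c1.1 c1.2))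
  by_cases c2 : s ∈ f ∧ t ∈ f
  · obtain ⟨h, o, o1, o2, h'⟩ := f4_aux2 hM hFE hs.swap ht.swap hst hf he hvf hqf hvq hue hve hpe
      hp.reverse hfM (fun z h1 h2 => hef z h2 h1) (fun h => (s2 h).symm) (fun h => (t2 h).symm)
      c2.1 c2.2
    exact Or.inr (Or.inr ⟨h, o, o2, o1, h'⟩)
  left
  by_cases hse : s ∈ e
  · have hte : t ∉ e := fun h => c1 ⟨hse, h⟩
    have htf : t ∈ f := t1.resolve_left hte
    have hsf : s ∉ f := fun h => c2 ⟨h, htf⟩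
    obtain ⟨y, y1, y2, y3, y4, h⟩ := f4_aux hM hFE hs ht he hf hue hve hpe hup hvf huf hqf hvq hp hfM
      huM s2 t2 hse htf hsf hte
    exact ⟨y, y1, y2, y3, y4, Or.inl h⟩
  · have hsf := s1.resolve_left hse
    have htf : t ∉ f := fun h => c2 ⟨hsf, h⟩
    have hte : t ∈ e := t1.resolve_right htf
    obtain ⟨y, y1, y2, y3, y4, h⟩ := f4_aux hM hFE ht hs he hf hue hve hpe hup hvf huf hqf hvq hp hfM
      huM t2 s2 hte hsf htf hse
    exact ⟨y, y1, y2, y4, y3, Or.inr h.symm⟩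

/-- Good five-sets. -/
def Good (E : Finset (Finset V)) (S : Finset V) : Prop :=
  S.card = 5 ∧ ∀ i ∈ S, ∀ j ∈ S, i ≠ j → ∃ k ∈ S, ∃ l ∈ S, ∃ m ∈ S, Tr E i k l ∧ Tr E j k m ∧
    l ≠ m ∧ l ≠ j ∧ m ≠ i

theorem card5 {a b c d e : V} (h1 : a ≠ b) (h2 : a ≠ c) (h3 : a ≠ d) (h4 : a ≠ e) (h5 : b ≠ c)
    (h6 : b ≠ d) (h7 : b ≠ e) (h8 : c ≠ d) (h9 : c ≠ e) (h10 : d ≠ e) :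
    ({a, b, c, d, e} : Finset V).card = 5 := by
  rw [Finset.card_insert_of_notMem (by simp [*]), Finset.card_insert_of_notMem (by simp [*]),
    Finset.card_insert_of_notMem (by simp [*]), Finset.card_pair h10]

theorem good_c5 {a b c d e : V} (h1 : Tr E a b c) (h2 : Tr E b c d) (h3 : Tr E c d e)
    (h4 : Tr E d e a) (h5 : Tr E e a b) : ∃ S, Good E S := by
  have ab := h1.2.1
  have ac := h1.2.2.1
  have bc := h1.2.2.2
  have bd := h2.2.2.1
  have cd := h3.2.1
  have ce := h3.2.2.1
  have de := h3.2.2.2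
  have da := h4.2.2.1
  have ea := h5.2.1
  have eb := h5.2.2.1
  refine ⟨{a, b, c, d, e}, card5 ab ac da.symm ea.symm bc bd eb.symm cd ce de, ?_⟩
  have key : ∀ i j k l m : V, Tr E i k l → Tr E j k m → l ≠ m → l ≠ j → m ≠ i →
      k ∈ ({a, b, c, d, e} : Finset V) → l ∈ ({a, b, c, d, e} : Finset V) →
      m ∈ ({a, b, c, d, e} : Finset V) →
      (∃ k ∈ ({a, b, c, d, e} : Finset V), ∃ l ∈ ({a, b, c, d, e} : Finset V),
      ∃ m ∈ ({a, b, c, d, e} : Finset V), Tr E i k l ∧ Tr E j k m ∧ l ≠ m ∧ l ≠ j ∧ m ≠ i) ∧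
      (∃ k ∈ ({a, b, c, d, e} : Finset V), ∃ l ∈ ({a, b, c, d, e} : Finset V),
      ∃ m ∈ ({a, b, c, d, e} : Finset V), Tr E j k l ∧ Tr E i k m ∧ l ≠ m ∧ l ≠ i ∧ m ≠ j) :=
    fun i j k l m x1 x2 x3 x4 x5 x6 x7 x8 => ⟨⟨k, x6, l, x7, m, x8, x1, x2, x3, x4, x5⟩,
      ⟨k, x6, m, x8, l, x7, x2, x1, x3.symm, x5, x4⟩⟩
  have kab := key a b d e c h4.rot.rot h2.swap' ce.symm eb ac.symm (by simp) (by simp) (by simp)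
  have kbc := key b c e a d h5.rot.rot h3.swap' da.symm ac bd.symm (by simp) (by simp) (by simp)
  have kcd := key c d a b e h1.rot.rot h4.swap' eb.symm bd ce.symm (by simp) (by simp) (by simp)
  have kde := key d e b c a h2.rot.rot h5.swap' ac.symm ce da.symm (by simp) (by simp) (by simp)
  have kea := key e a c d b h3.rot.rot h1.swap' bd.symm da eb.symm (by simp) (by simp) (by simp)
  have kac := key a c d e b h4.rot.rot h2.rot eb ce.symm ab.symm (by simp) (by simp) (by simp)
  have kbd := key b d e a c h5.rot.rot h3.rot ac da.symm bc.symm (by simp) (by simp) (by simp)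
  have kce := key c e a b d h1.rot.rot h4.rot bd eb.symm cd.symm (by simp) (by simp) (by simp)
  have kda := key d a b c e h2.rot.rot h5.rot ce ac.symm de.symm (by simp) (by simp) (by simp)
  have keb := key e b c d a h3.rot.rot h1.rot da bd.symm ea.symm (by simp) (by simp) (by simp)
  intro i hi j hj hij
  rw [Finset.mem_insert, Finset.mem_insert, Finset.mem_insert, Finset.mem_insert,
    Finset.mem_singleton] at hi hj
  rcases hi with rfl | rfl | rfl | rfl | rfl <;> rcases hj with rfl | rfl | rfl | rfl | rfl <;>
  first
  | exact absurd rfl hij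
  | exact kab.1 | exact kab.2 | exact kbc.1 | exact kbc.2 | exact kcd.1 | exact kcd.2
  | exact kde.1 | exact kde.2 | exact kea.1 | exact kea.2 | exact kac.1 | exact kac.2
  | exact kbd.1 | exact kbd.2 | exact kce.1 | exact kce.2 | exact kda.1 | exact kda.2
  | exact keb.1 | exact keb.2

/-- The K23 pattern: all triples with one vertex in x,y and two among a,b,c. -/
theorem good_k23 {a b c x y : V} (hxy : x ≠ y) (h1 : Tr E x a b) (h2 : Tr E x b c) (h3 : Tr E x c a)
    (h4 : Tr E y a b) (h5 : Tr E y b c) (h6 : Tr E y c a) : ∃ S, Good E S := by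
  have xa := h1.2.1
  have xb := h1.2.2.1
  have xc := h2.2.2.1
  have ya := h4.2.1
  have yb := h4.2.2.1
  have yc := h5.2.2.1
  have ab := h1.2.2.2
  have bc := h2.2.2.2
  have ca := h3.2.2.2
  refine ⟨{a, b, c, x, y}, card5 ab ca.symm xa.symm ya.symm bc xb.symm yb.symm xc.symm yc.symm hxy, ?_⟩
  have key : ∀ i j k l m : V, Tr E i k l → Tr E j k m → l ≠ m → l ≠ j → m ≠ i →
      k ∈ ({a, b, c, x, y} : Finset V) → l ∈ ({a, b, c, x, y} : Finset V) →
      m ∈ ({a, b, c, x, y} : Finset V) →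
      (∃ k ∈ ({a, b, c, x, y} : Finset V), ∃ l ∈ ({a, b, c, x, y} : Finset V),
      ∃ m ∈ ({a, b, c, x, y} : Finset V), Tr E i k l ∧ Tr E j k m ∧ l ≠ m ∧ l ≠ j ∧ m ≠ i) ∧
      (∃ k ∈ ({a, b, c, x, y} : Finset V), ∃ l ∈ ({a, b, c, x, y} : Finset V),
      ∃ m ∈ ({a, b, c, x, y} : Finset V), Tr E j k l ∧ Tr E i k m ∧ l ≠ m ∧ l ≠ i ∧ m ≠ j) :=
    fun i j k l m x1 x2 x3 x4 x5 x6 x7 x8 => ⟨⟨k, x6, l, x7, m, x8, x1, x2, x3, x4, x5⟩,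
      ⟨k, x6, m, x8, l, x7, x2, x1, x3.symm, x5, x4⟩⟩
  have kxy := key x y a b c h1 h6.swap' bc yb.symm xc.symm (by simp) (by simp) (by simp)
  have kxa := key x a b c y h2 h4.rot yc.symm ca hxy.symm (by simp) (by simp) (by simp)
  have kxb := key x b c a y h3 h5.rot ya.symm ab hxy.symm (by simp) (by simp) (by simp)
  have kxc := key x c a b y h1 h6.rot yb.symm bc hxy.symm (by simp) (by simp) (by simp)
  have kya := key y a b c x h5 h1.rot xc.symm ca hxy (by simp) (by simp) (by simp)
  have kyb := key y b c a x h6 h2.rot xa.symm ab hxy (by simp) (by simp) (by simp)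
  have kyc := key y c a b x h4 h3.rot xb.symm bc hxy (by simp) (by simp) (by simp)
  have kab := key a b c x y h3.rot.swap h5.rot hxy xb ya (by simp) (by simp) (by simp)
  have kbc := key b c a x y h1.rot.swap h6.rot hxy xc yb (by simp) (by simp) (by simp)
  have kca := key c a b x y h2.rot.swap h4.rot hxy xa yc (by simp) (by simp) (by simp)
  intro i hi j hj hij
  rw [Finset.mem_insert, Finset.mem_insert, Finset.mem_insert, Finset.mem_insert,
    Finset.mem_singleton] at hi hj
  rcases hi with rfl | rfl | rfl | rfl | rfl <;> rcases hj with rfl | rfl | rfl | rfl | rfl <;>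
  first
  | exact absurd rfl hij
  | exact kxy.1 | exact kxy.2 | exact kxa.1 | exact kxa.2 | exact kxb.1 | exact kxb.2
  | exact kxc.1 | exact kxc.2 | exact kya.1 | exact kya.2 | exact kyb.1 | exact kyb.2
  | exact kyc.1 | exact kyc.2 | exact kab.1 | exact kab.2 | exact kbc.1 | exact kbc.2
  | exact kca.1 | exact kca.2

end local_analysis

section final
variable {V : Type*} [DecidableEq V] {E F : Finset (Finset V)}

theorem cfgII_beta (hM : MinC E) {u v s t o : V} {g : Finset V} (h : CfgII E u v s t g)
    (hust : Tr E u s t) (ou : o ≠ u) (_ov : o ≠ v) (os : o ≠ s) (ot : o ≠ t)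
    (hvso : Tr E v s o) : ∃ S, Good E S := by
  obtain ⟨huvs, huvt, hst, hg, hsg, htg, hug, hvg⟩ := h
  have hog : o ∈ g := by
    by_contra hog
    have := huvs.2
    have := huvt.2
    refine tri_edges hM (a := s) (b := t) (c := v) hg huvt.1 hvso.1 hsg htg (by simp) (by simp)
      (by simp) (by simp) hst huvt.2.2.2.symm ?_ ?_ ?_
    all_goals
      intro z
      simp only [Finset.mem_insert, Finset.mem_singleton]
      grind
  have hsto : Tr E s t o := tr_of_three hM hg hsg htg hog hst os.symm ot.symm
  have hvt := huvt.2.2.2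
  have hus := huvs.2.2.1
  have hut := huvt.2.2.1
  have huv := huvt.2.1
  have hvs := huvs.2.2.2
  -- completion steps
  have hov : ∀ y, y ≠ s → y ≠ t → Tr E o v y → ∃ S, Good E S := by
    intro y y1 y3 hy
    have hyu : y = u := by
      by_contra hyu
      exact tri_false hM hy huvt.rot hsto.rot y3 ou.symm hvs.symm hyu hus y1
    subst hyu
    exact good_c5 hy.rot.swap hvso.swap' hsto.rot.rot hust.rot huvt.rot.rot
  have hot : ∀ y, y ≠ s → y ≠ v → Tr E o t y → ∃ S, Good E S := by
    intro y y1 y3 hy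
    have hyu : y = u := by
      by_contra hyu
      exact tri_false hM hy huvt.rot.swap hvso.swap' y3 ou.symm hst hyu hus y1
    subst hyu
    exact good_c5 huvs hvso hsto.swap' hy huvt.rot.rot
  rcases f4 hM hsto.swap' hvso.rot hvt.symm with ⟨y, ys, yo, yt, yv, h | h⟩ |
    ⟨h, y, ys, yo, yt, yv, h' | h'⟩ | ⟨h, -⟩
  · exact hov y ys yt h.2
  · exact hot y ys yv h.1
  · exact hot y ys yv h'
  · exact hov y ys yt h'
  · exact good_k23 ou h hvso.rot.rot hsto.rot.rot huvt.swap' huvs hust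

theorem cfgII_good (hM : MinC E) {u v s t : V} {g : Finset V} (h : CfgII E u v s t g) :
    ∃ S, Good E S := by
  have h0 := h
  obtain ⟨huvs, huvt, hst, hg, hsg, htg, hug, hvg⟩ := h
  have alpha : ∀ {u v s t y : V} {g : Finset V}, CfgII E u v s t g → y ≠ u → y ≠ v → y ≠ s →
      y ≠ t → Tr E u s y → Tr E v t y → ∃ S, Good E S := by
    intro u v s t y g h yu yv ys yt h1 h2
    obtain ⟨huvs, huvt, hst, hg, hsg, htg, hug, hvg⟩ := h
    have hyg : y ∈ g := by
      by_contra hyg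
      have := huvs.2
      have := huvt.2
      refine tri_edges hM (a := s) (b := t) (c := y) hg h2.1 h1.1 hsg htg (by simp) (by simp)
        (by simp) (by simp) hst yt.symm ?_ ?_ ?_
      all_goals
        intro z
        simp only [Finset.mem_insert, Finset.mem_singleton]
        grind
    have hsty : Tr E s t y := tr_of_three hM hg hsg htg hyg hst ys.symm yt.symm
    exact good_c5 huvs.rot.rot huvt h2 hsty.rot.swap'.swap' h1.rot.swap
  rcases f4 hM huvs huvt hst with ⟨y, yu, yv, ys, yt, h | h⟩ | ⟨h, o, ou, ov, os, ot, h' | h'⟩ |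
    ⟨h, o, ou, ov, os, ot, h' | h'⟩
  · exact alpha h0 yu yv ys yt h.1 h.2
  · exact alpha ⟨huvs.swap, huvt.swap, hst, hg, hsg, htg, hvg, hug⟩ yv yu ys yt h.1 h.2
  · exact cfgII_beta hM h0 h ou ov os ot h'
  · exact cfgII_beta hM (g := g) ⟨huvt, huvs, hst.symm, hg, htg, hsg, hug, hvg⟩ h.swap' ou ov ot os h'
  · exact cfgII_beta hM (g := g) ⟨huvs.swap, huvt.swap, hst, hg, hsg, htg, hvg, hug⟩ h ov ou os ot h'
  · exact cfgII_beta hM (g := g) ⟨huvt.swap, huvs.swap, hst.symm, hg, htg, hsg, hvg, hug⟩ h.swap' ov ou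
      ot os h'

theorem bull_good (hM : MinC E)
    (H : ∀ a b c, Tr E a b c → ∃ p r, Tr E a c p ∧ Tr E b c r ∧ p ≠ r ∧ p ≠ b ∧ r ≠ a)
    {a b c p q : V} (h1 : Tr E a b c) (h2 : Tr E a b p) (h3 : Tr E a b q) (h4 : Tr E b c p)
    (h5 : Tr E c a q) (hpq : p ≠ q) : ∃ S, Good E S := by
  obtain ⟨-, z, -, hz, -, -, za⟩ := H a c q h5.swap
  obtain ⟨-, z', -, hz', -, -, zb⟩ := H b c p h4
  have c5 : Tr E p c q → ∃ S, Good E S := fun h =>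
    good_c5 h2 h4.swap' h h5.swap' h3.rot.rot
  by_cases e1 : z = p
  · subst e1; exact c5 hz.rot.rot
  by_cases e2 : z' = q
  · subst e2; exact c5 hz'.swap
  have e3 : z = b := by
    by_contra e3
    exact tri_false hM hz h3.rot.swap h4 e3 h1.2.2.1 hpq za h2.2.2.1 e1
  have e4 : z' = a := by
    by_contra e4
    exact tri_false hM hz' h2.rot.rot h5.swap e4 h1.2.2.2 hpq.symm zb h3.2.2.2 e2
  subst e3 e4
  exact good_k23 hpq h2.rot.rot h4.rot.rot hz'.swap h3.rot.rot hz.rot h5.rot.rot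

theorem typeI_good (hM : MinC E)
    (H : ∀ a b c, Tr E a b c → ∃ p r, Tr E a c p ∧ Tr E b c r ∧ p ≠ r ∧ p ≠ b ∧ r ≠ a)
    {a b c : V} (h : Tr E a b c) : ∃ S, Good E S := by
  obtain ⟨p, r, hp, hr, hpr, pb, ra⟩ := H a b c h
  obtain ⟨q, q', hq, hq', hqq, qc, qb⟩ := H b c a h.rot
  have hqpr : ∀ q, Tr E a b q → q ≠ c → q = p ∨ q = r := by
    intro q hq qc
    by_contra hcon
    push Not at hcon
    exact tri_false hM hq hr hp.swap qc ra pb hcon.2 hpr.symm hcon.1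
  rcases hqpr q hq.swap qc with rfl | rfl
  · have e : q' = r := by
      by_contra e
      exact tri_false hM hq.swap hr hq' qc ra qb hpr (Ne.symm e) hqq
    subst e
    exact bull_good hM H h.rot.rot hp.swap hq' hq.swap hr hqq
  · obtain ⟨r2, q2, hr2, hq2, hrq, r2a, q2c⟩ := H c a b h.rot.rot
    rcases hqpr q2 hq2 q2c with rfl | rfl
    · exact bull_good hM H h.swap hq2.swap hq hp hr.swap hpr
    · have e : r2 = p := by
        by_contra e
        exact tri_false hM hq2 hr2.swap hp.swap q2c r2a pb hrq.symm e hpr.symm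
      subst e
      exact bull_good hM H h.rot hr2.swap hr hp.swap hq2 hrq

theorem exists_good (hM : MinC E) {a b c : V} (h : Tr E a b c) : ∃ S, Good E S := by
  by_cases hII : ∃ u v s t g, CfgII E u v s t g
  · obtain ⟨u, v, s, t, g, hh⟩ := hII
    exact cfgII_good hM hh
  · exact typeI_good hM (fun a b c h => (f3 hM h).resolve_right hII) h

/-- Invariant for attaching 2-edges inside `S`. -/
def AttInv (S : Finset V) (E : Finset (Finset V)) (f : V → V) : Prop :=
  ¬ HasCyc E ∧ ∀ i ∈ S, ∀ j ∈ S, ∀ W n, LP E i j W n → f i = f j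

theorem AttInv.step {S : Finset V} {f : V → V} (h : AttInv S E f) {p q : V} (hp : p ∈ S) (hq : q ∈ S)
    (hpq : f p ≠ f q) : AttInv S (insert {p, q} E) (fun x => if f x = f q then f p else f x) := by
  have hne : p ≠ q := fun hh => hpq (hh ▸ rfl)
  refine ⟨fun hc => ?_, fun i hi j hj W n hl => ?_⟩
  · rcases hc.split hne with hc | ⟨W, n, -, hl⟩
    · exact h.1 hc
    · exact hpq (h.2 p hp q hq W n hl)
  · beta_reduce
    rcases hl.split with hl | ⟨a, b, W1, W2, n1, n2, ha, hb, hab, l1, l2, -⟩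
    · rw [h.2 i hi j hj W n hl]
    · simp only [Finset.mem_insert, Finset.mem_singleton] at ha hb
      rcases ha with rfl | rfl <;> rcases hb with rfl | rfl
      · exact absurd rfl hab
      · rw [h.2 i hi _ hp _ _ l1, ← h.2 _ hq j hj _ _ l2]; simp
      · rw [h.2 i hi _ hq _ _ l1, ← h.2 _ hp j hj _ _ l2]; simp
      · exact absurd rfl hab

theorem good_path (hM : MinC E) {S : Finset V} (hS : Good E S) {x y : V} {W : Finset V} {n : ℕ}
    (hl : LP (E.filter (fun e => ¬ (e ⊆ S ∧ e.card = 3))) x y W n) (hy : y ∈ S) :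
    ∀ z ∈ W, z ∈ S → z = y := by
  have hFE : E.filter (fun e => ¬ (e ⊆ S ∧ e.card = 3)) ⊆ E := Finset.filter_subset _ _
  -- edges outside meet S at most once
  have meet : ∀ e ∈ E.filter (fun e => ¬ (e ⊆ S ∧ e.card = 3)), ∀ i ∈ e, ∀ j ∈ e, i ∈ S → j ∈ S →
      i = j := by
    intro e he i hi j hj hiS hjS
    by_contra hij
    obtain ⟨k, hk, l, hl, m, hm, h1, h2, hlm, hlj, hmi⟩ := hS.2 i hiS j hjS hij
    have hez : ∀ z ∈ e, z ∈ S → z = i ∨ z = j := by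
      intro z hz hzS
      by_contra hcon
      push Not at hcon
      have hcard : ({i, j, z} : Finset V).card = 3 :=
        Finset.card_eq_three.2 ⟨i, j, z, hij, hcon.1.symm, hcon.2.symm, rfl⟩
      have heq : {i, j, z} = e := by
        apply Finset.eq_of_subset_of_card_le
        · intro w hw
          simp only [Finset.mem_insert, Finset.mem_singleton] at hw
          rcases hw with rfl | rfl | rfl <;> assumption
        · rcases hM.size e (hFE he) with h | h <;> omega
      refine (Finset.mem_filter.1 he).2 ⟨?_, heq ▸ hcard⟩
      rw [← heq]
      intro w hw
      simp only [Finset.mem_insert, Finset.mem_singleton] at hw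
      rcases hw with rfl | rfl | rfl <;> assumption
    refine tri_edges hM (a := i) (b := k) (c := j) h1.1 h2.1 (hFE he) (by simp) (by simp) (by simp)
      (by simp) hj hi h1.2.1 h2.2.1.symm ?_ ?_ ?_
    · have := h1.2
      have := h2.2
      intro z
      simp only [Finset.mem_insert, Finset.mem_singleton]
      grind
    · intro z hz hz2
      have := h1.2
      have := h2.2
      simp only [Finset.mem_insert, Finset.mem_singleton] at hz2
      have := hez z hz
      grind
    · intro z hz hz2
      have := h1.2
      have := h2.2
      simp only [Finset.mem_insert, Finset.mem_singleton] at hz2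
      have := hez z hz
      grind
  induction hl with
  | nil x => simp
  | @cons x w y e W n he hx hw hne hz hp ih =>
    intro z hzW hzS
    by_contra hzy
    have ih := ih hy
    have hzW' : z ∉ W := fun h => hzy (ih z h hzS)
    have hze : z ∈ e := (Finset.mem_union.1 hzW).resolve_right hzW'
    have hzw : z ≠ w := fun h => hzW' (h ▸ hp.left_mem)
    have hP := LP.cons he hze hw hzw hz hp
    have hPS : ∀ t ∈ e ∪ W, t ∈ S → t = z ∨ t = y := by
      intro t ht htS
      rcases Finset.mem_union.1 ht with ht | ht
      · exact Or.inl (meet e he t ht z hze htS hzS)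
      · exact Or.inr (ih t ht htS)
    obtain ⟨k, hk, l, hl, m, hm, h1, h2, hlm, hlj, hmi⟩ := hS.2 z hzS y hy hzy
    have hQ := (hP.mono hFE).append (LP.single h2.1 (x := y) (y := k) (by simp) (by simp) h2.2.1) (by
      intro t ht ht2
      have := hPS t ht
      have := h1.2
      have := h2.2
      simp only [Finset.mem_insert, Finset.mem_singleton] at ht2
      grind)
    refine cyc_falseT hM (by omega) hQ h1 ?_
    intro hlW
    rcases Finset.mem_union.1 hlW with h | h
    · rcases hPS l h hl with h | h
      · exact h1.2.2.1 h.symm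
      · exact hlj h
    · simp only [Finset.mem_insert, Finset.mem_singleton] at h
      rcases h with h | h | h
      · exact hlj h
      · exact h1.2.2.2 h.symm
      · exact hlm h

theorem good_false (hM : MinC E)
    (hK5 : ¬ ∃ S : Finset V, S.card = 5 ∧ ∀ e ⊆ S, e.card = 3 → e ∈ E)
    {S : Finset V} (hS : Good E S) : False := by
  obtain ⟨T, hTS, hT3, hTE⟩ : ∃ T ⊆ S, T.card = 3 ∧ T ∉ E := by
    by_contra hcon
    push Not at hcon
    exact hK5 ⟨S, hS.1, hcon⟩
  obtain ⟨a, b, c, hab, hac, hbc, rfl⟩ := Finset.card_eq_three.1 hT3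
  have hcd : (S \ {a, b, c}).card = 2 := by
    rw [Finset.card_sdiff_of_subset hTS, hS.1, hT3]
  obtain ⟨d, e, hde, hSde⟩ := Finset.card_eq_two.1 hcd
  have memS : ∀ z, z ∈ S ↔ z = a ∨ z = b ∨ z = c ∨ z = d ∨ z = e := by
    intro z
    have h1 : z ∈ S \ {a, b, c} ↔ z ∈ ({d, e} : Finset V) := by rw [hSde]
    have h2 := @hTS z
    simp only [Finset.mem_sdiff, Finset.mem_insert, Finset.mem_singleton] at h1 h2
    tauto
  have hd : d ∈ S \ {a, b, c} := by rw [hSde]; simp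
  have he : e ∈ S \ {a, b, c} := by rw [hSde]; simp
  simp only [Finset.mem_sdiff, Finset.mem_insert, Finset.mem_singleton, not_or] at hd he
  obtain ⟨hdS, hda, hdb, hdc⟩ := hd
  obtain ⟨heS, hea, heb, hec⟩ := he
  have haS : a ∈ S := hTS (by simp)
  have hbS : b ∈ S := hTS (by simp)
  have hcS : c ∈ S := hTS (by simp)
  set E0 := E.filter (fun e => ¬ (e ⊆ S ∧ e.card = 3)) with hE0
  have hFE : E0 ⊆ E := Finset.filter_subset _ _
  have i0 : AttInv S E0 id := ⟨fun h => hM.cyc (h.mono hFE), fun i hi j hj W n hl =>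
    good_path hM hS hl hj i hl.left_mem hi⟩
  have i1 := i0.step haS hdS (Ne.symm hda)
  have i2 := i1.step hbS hdS (by grind)
  have i3 := i2.step hcS hdS (by grind)
  have i4 := i3.step haS heS (by grind)
  have hcol : Col (insert {a, e} (insert {c, d} (insert {b, d} (insert {a, d} E0)))) := by
    apply hM.min
    · intro g hg
      simp only [Finset.mem_insert] at hg
      rcases hg with rfl | rfl | rfl | rfl | hg
      · exact Or.inl (Finset.card_pair (Ne.symm hea))
      · exact Or.inl (Finset.card_pair (Ne.symm hdc))
      · exact Or.inl (Finset.card_pair (Ne.symm hdb))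
      · exact Or.inl (Finset.card_pair (Ne.symm hda))
      · exact hM.size g (hFE hg)
    · exact i4.1
    · intro g hg h3
      simp only [Finset.mem_insert] at hg
      rcases hg with rfl | rfl | rfl | rfl | hg
      · rw [Finset.card_pair (Ne.symm hea)] at h3; omega
      · rw [Finset.card_pair (Ne.symm hdc)] at h3; omega
      · rw [Finset.card_pair (Ne.symm hdb)] at h3; omega
      · rw [Finset.card_pair (Ne.symm hda)] at h3; omega
      · exact hFE hg
    · obtain ⟨k, hk, l, hl, m, hm, h1, -⟩ := hS.2 a haS b hbS hab
      refine ⟨_, h1.1, h1.card, ?_⟩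
      intro hg
      have h3 := h1.card
      simp only [Finset.mem_insert] at hg
      rcases hg with hg | hg | hg | hg | hg
      · rw [hg, Finset.card_pair (Ne.symm hea)] at h3; omega
      · rw [hg, Finset.card_pair (Ne.symm hdc)] at h3; omega
      · rw [hg, Finset.card_pair (Ne.symm hdb)] at h3; omega
      · rw [hg, Finset.card_pair (Ne.symm hda)] at h3; omega
      · refine (Finset.mem_filter.1 hg).2 ⟨?_, h3⟩
        intro w hw
        simp only [Finset.mem_insert, Finset.mem_singleton] at hw
        rcases hw with rfl | rfl | rfl <;> assumption
  obtain ⟨col, hcol⟩ := hcol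
  have pairc : ∀ x y : V, (∃ i ∈ ({x, y} : Finset V), ∃ j ∈ ({x, y} : Finset V), col i ≠ col j) →
      col x ≠ col y := by
    rintro x y ⟨i, hi, j, hj, hij⟩
    simp only [Finset.mem_insert, Finset.mem_singleton] at hi hj
    rcases hi with rfl | rfl <;> rcases hj with rfl | rfl
    · exact absurd rfl hij
    · exact hij
    · exact hij.symm
    · exact absurd rfl hij
  have cae := pairc a e (hcol _ (by simp))
  have ccd := pairc c d (hcol _ (by simp))
  have cbd := pairc b d (hcol _ (by simp))
  have cad := pairc a d (hcol _ (by simp))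
  apply hM.ncol
  refine ⟨col, fun g hg => ?_⟩
  by_cases hgS : g ⊆ S ∧ g.card = 3
  swap
  · exact hcol g (by
      simp only [Finset.mem_insert]
      exact Or.inr (Or.inr (Or.inr (Or.inr (Finset.mem_filter.2 ⟨hg, hgS⟩)))))
  obtain ⟨hgS, hg3⟩ := hgS
  have fin2 : ∀ i j k : Fin 2, i ≠ j → i ≠ k → j = k := by decide
  have hde' := fin2 _ _ _ cad cae
  have cbe : col b ≠ col e := hde' ▸ cbd
  have cce : col c ≠ col e := hde' ▸ ccd
  have h1 : d ∈ g ∨ e ∈ g := by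
    by_contra hcon
    push Not at hcon
    apply hTE
    have : g = {a, b, c} := by
      apply Finset.eq_of_subset_of_card_le
      · intro w hw
        have := (memS w).1 (hgS hw)
        simp only [Finset.mem_insert, Finset.mem_singleton]
        rcases this with h | h | h | h | h
        · exact Or.inl h
        · exact Or.inr (Or.inl h)
        · exact Or.inr (Or.inr h)
        · exact absurd (h ▸ hw) hcon.1
        · exact absurd (h ▸ hw) hcon.2
      · omega
    rw [← this]; exact hg
  have h2 : a ∈ g ∨ b ∈ g ∨ c ∈ g := by
    by_contra hcon
    push Not at hcon
    have : g ⊆ {d, e} := by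
      intro w hw
      have := (memS w).1 (hgS hw)
      simp only [Finset.mem_insert, Finset.mem_singleton]
      rcases this with h | h | h | h | h
      · exact absurd (h ▸ hw) hcon.1
      · exact absurd (h ▸ hw) hcon.2.1
      · exact absurd (h ▸ hw) hcon.2.2
      · exact Or.inl h
      · exact Or.inr h
    have := Finset.card_le_card this
    rw [Finset.card_pair hde] at this
    omega
  rcases h1 with h1 | h1 <;> rcases h2 with h2 | h2 | h2
  · exact ⟨_, h2, _, h1, cad⟩
  · exact ⟨_, h2, _, h1, cbd⟩
  · exact ⟨_, h2, _, h1, ccd⟩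
  · exact ⟨_, h2, _, h1, cae⟩
  · exact ⟨_, h2, _, h1, cbe⟩
  · exact ⟨_, h2, _, h1, cce⟩

theorem main_col (N : ℕ) : ∀ E : Finset (Finset V), (E.filter (fun e => e.card = 3)).card = N →
    (∀ e ∈ E, e.card = 2 ∨ e.card = 3) → ¬ HasCyc E →
    (¬ ∃ S : Finset V, S.card = 5 ∧ ∀ e ⊆ S, e.card = 3 → e ∈ E) → Col E := by
  induction N using Nat.strong_induction_on with
  | _ N ih =>
  intro E hN hsize hcyc hK5
  by_contra hcol
  have hM : MinC E := by
    refine ⟨hsize, hcyc, hcol, ?_⟩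
    intro F hF hFc hFE hex
    refine ih _ ?_ F rfl hF hFc ?_
    · rw [← hN]
      apply Finset.card_lt_card
      obtain ⟨e, heE, he3, heF⟩ := hex
      refine ⟨?_, ?_⟩
      · intro g hg
        simp only [Finset.mem_filter] at hg
        exact Finset.mem_filter.2 ⟨hFE g hg.1 hg.2, hg.2⟩
      · intro hsub
        exact heF (Finset.mem_filter.1 (hsub (Finset.mem_filter.2 ⟨heE, he3⟩))).1
    · rintro ⟨S, hS, h⟩
      exact hK5 ⟨S, hS, fun e he h3 => hFE e (h e he h3) h3⟩
  by_cases h2 : ∀ e ∈ E, e.card = 2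
  · exact hcol (forest_col E h2 hcyc)
  · push Not at h2
    obtain ⟨e, he, hne⟩ := h2
    obtain ⟨a, b, c, hab, hac, hbc, rfl⟩ := Finset.card_eq_three.1 ((hsize e he).resolve_left hne)
    obtain ⟨S, hS⟩ := exists_good hM ⟨he, hab, hac, hbc⟩
    exact good_false hM hK5 hS

end final

/-- A 3-uniform linear-cycle-free hypergraph not containing `K₅³` is 2-colorable. -/
theorem two_colorable {V : Type*} [Fintype V] [DecidableEq V] (E : Finset (Finset V))
    (h3 : ∀ e ∈ E, e.card = 3) (hcyc : ¬ HasLinearCycle E)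
    (hK5 : ¬ ∃ S : Finset V, S.card = 5 ∧ ∀ e ⊆ S, e.card = 3 → e ∈ E) :
    ∃ c : V → Fin 2, ∀ e ∈ E, ∃ x ∈ e, ∃ y ∈ e, c x ≠ c y := by
  exact main_col _ E rfl (fun e he => Or.inr (h3 e he)) (fun hc => hcyc (hc.toLinear h3)) hK5
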